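/- For every ε ∈ (0,1) and every P ∈ (0,∞), there exist a constant c > 0 and N ∈ ℕ such that for all n ≥ N, log M*(Wⁿ, ε, P) ≥ n·C(P) + √(n·V(P))·Φ⁻¹(ε) + (1/2)·log n − c. (All logarithms are natural logarithms.) -/

import Mathlib

open MeasureTheory ProbabilityTheory Real
open scoped ENNReal

noncomputable section

/-- Gaussian capacity `C(P) = (1/2) log(1+P)` (natural logarithm). -/
def gaussC (P : ℝ) : ℝ := Real.log (1 + P) / 2

/-- Gaussian dispersion `V(P) = P(P+2)/(2(P+1)^2)` (in nats). -/
def gaussV (P : ℝ) : ℝ := P * (P + 2) / (2 * (P + 1) ^ 2)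

/-- Standard normal cumulative distribution function. -/
def Phi (a : ℝ) : ℝ := ∫ u in Set.Iic a, (Real.sqrt (2 * π))⁻¹ * Real.exp (-u ^ 2 / 2)

/-- Inverse of the standard normal CDF, `Φ⁻¹(ε) = sup {a : Φ(a) ≤ ε}`. -/
def PhiInv (ε : ℝ) : ℝ := sSup {a : ℝ | Phi a ≤ ε}

/-- The `n`-fold AWGN channel with unit noise variance: `Wn n x D` is the probability
that `x + Z ∈ D` where `Z` is an i.i.d. standard Gaussian vector. -/
def Wn (n : ℕ) (x : Fin n → ℝ) (D : Set (Fin n → ℝ)) : ℝ≥0∞ :=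
  (Measure.pi fun _ : Fin n => gaussianReal 0 1) {z | (fun i => x i + z i) ∈ D}

/-- Existence of an `(n, M, ε, P)_av`-code: `M` codewords satisfying the maximal power
constraint `‖x(m)‖₂² ≤ nP`, with pairwise disjoint measurable decoding regions and
average error probability at most `ε`. -/
def IsCode (n M : ℕ) (ε P : ℝ) : Prop :=
  ∃ (x : Fin M → Fin n → ℝ) (D : Fin M → Set (Fin n → ℝ)),
    (∀ m, ∑ i, x m i ^ 2 ≤ n * P) ∧
    (∀ m, MeasurableSet (D m)) ∧
    (∀ m m', m ≠ m' → Disjoint (D m) (D m')) ∧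
    (1 / M : ℝ) * ∑ m, (Wn n (x m) (D m)ᶜ).toReal ≤ ε

/-- `M*(Wⁿ, ε, P)`: maximal size of an `(n, M, ε, P)_av`-code. -/
def Mstar (n : ℕ) (ε P : ℝ) : ℕ := sSup {M : ℕ | IsCode n M ε P}

/-- The standard normal density. -/
def normalDensity (x : ℝ) : ℝ := (Real.sqrt (2 * π))⁻¹ * Real.exp (-x ^ 2 / 2)

/-- The standard normal distribution on the line. -/
abbrev stdNormal : Measure ℝ := gaussianReal 0 1

lemma normalDensity_eq (x : ℝ) : normalDensity x = gaussianPDFReal 0 1 x := by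
  simp [normalDensity, gaussianPDFReal]

lemma normalDensity_pos (x : ℝ) : 0 < normalDensity x := by
  rw [normalDensity]; positivity

lemma continuous_normalDensity : Continuous normalDensity := by
  unfold normalDensity; fun_prop

lemma integrable_normalDensity : Integrable normalDensity := by
  rw [funext normalDensity_eq]; exact integrable_gaussianPDFReal 0 1

lemma normalDensity_le_exp (x : ℝ) : normalDensity x ≤ Real.exp (-x ^ 2 / 2) := by
  rw [normalDensity]
  refine mul_le_of_le_one_left (by positivity) (inv_le_one_of_one_le₀ ?_)
  rw [Real.one_le_sqrt]
  linarith [Real.pi_gt_three]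

lemma normalDensity_le_one (x : ℝ) : normalDensity x ≤ 1 :=
  (normalDensity_le_exp x).trans (Real.exp_le_one_iff.2 (by nlinarith [sq_nonneg x]))

lemma Phi_eq_measure (a : ℝ) : Phi a = stdNormal.real (Set.Iic a) := by
  rw [Measure.real, stdNormal, gaussianReal_apply_eq_integral 0 one_ne_zero, ENNReal.toReal_ofReal]
  · exact integral_congr_ae (Filter.Eventually.of_forall normalDensity_eq)
  · exact setIntegral_nonneg measurableSet_Iic fun x _ => gaussianPDFReal_nonneg 0 1 x

lemma ofReal_Phi (a : ℝ) : ENNReal.ofReal (Phi a) = stdNormal (Set.Iic a) := by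
  rw [Phi_eq_measure, ofReal_measureReal]

lemma Phi_nonneg (a : ℝ) : 0 ≤ Phi a := by
  rw [Phi_eq_measure]; exact measureReal_nonneg

lemma Phi_le_one (a : ℝ) : Phi a ≤ 1 := by
  rw [Phi_eq_measure]; exact measureReal_le_one

lemma Phi_mono : Monotone Phi := fun a b h => by
  rw [Phi_eq_measure, Phi_eq_measure]; exact measureReal_mono (Set.Iic_subset_Iic.2 h)

lemma hasDerivAt_Phi (a : ℝ) : HasDerivAt Phi (normalDensity a) a := by
  have h : Phi = fun x => Phi 0 + ∫ u in (0 : ℝ)..x, normalDensity u := by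
    funext x
    rw [← intervalIntegral.integral_Iic_sub_Iic integrable_normalDensity.integrableOn
      integrable_normalDensity.integrableOn]
    simp [Phi, normalDensity]
  rw [h]
  exact (intervalIntegral.integral_hasDerivAt_right
    integrable_normalDensity.intervalIntegrable
    (continuous_normalDensity.stronglyMeasurableAtFilter _ _)
    continuous_normalDensity.continuousAt).const_add _

lemma continuous_Phi : Continuous Phi :=
  continuous_iff_continuousAt.2 fun x => (hasDerivAt_Phi x).continuousAt

lemma strictMono_Phi : StrictMono Phi :=
  strictMono_of_deriv_pos fun x => by rw [(hasDerivAt_Phi x).deriv]; exact normalDensity_pos x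

lemma tendsto_Phi_atTop : Filter.Tendsto Phi Filter.atTop (nhds 1) := by
  have h : Phi = fun a => cdf stdNormal a := by
    funext a; rw [cdf_eq_real, Phi_eq_measure]
  rw [h]; exact tendsto_cdf_atTop _

lemma tendsto_Phi_atBot : Filter.Tendsto Phi Filter.atBot (nhds 0) := by
  have h : Phi = fun a => cdf stdNormal a := by
    funext a; rw [cdf_eq_real, Phi_eq_measure]
  rw [h]; exact tendsto_cdf_atBot _

lemma Phi_PhiInv {ε : ℝ} (hε : ε ∈ Set.Ioo (0 : ℝ) 1) : Phi (PhiInv ε) = ε := by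
  obtain ⟨a, ha⟩ := (tendsto_Phi_atBot.eventually_lt_const hε.1).exists
  obtain ⟨b, hb⟩ := (tendsto_Phi_atTop.eventually_const_lt hε.2).exists
  have hab : a ≤ b := (strictMono_Phi.lt_iff_lt.1 (ha.trans hb)).le
  obtain ⟨q, -, hq⟩ := intermediate_value_Icc hab continuous_Phi.continuousOn ⟨ha.le, hb.le⟩
  have : {a : ℝ | Phi a ≤ ε} = Set.Iic q := by
    ext x; simp [← hq, strictMono_Phi.le_iff_le]
  rw [PhiInv, this, csSup_Iic, hq]

/-- A third-order Taylor estimate with a crude constant. -/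
lemma abs_taylor_two_le {f f₁ f₂ f₃ : ℝ → ℝ} {K : ℝ} (h₁ : ∀ x, HasDerivAt f (f₁ x) x)
    (h₂ : ∀ x, HasDerivAt f₁ (f₂ x) x) (h₃ : ∀ x, HasDerivAt f₂ (f₃ x) x)
    (hK : ∀ x, |f₃ x| ≤ K) (x y : ℝ) :
    |f (x + y) - f x - f₁ x * y - f₂ x * y ^ 2 / 2| ≤ K * |y| ^ 3 := by
  have hK0 : 0 ≤ K := (abs_nonneg _).trans (hK 0)
  have key : ∀ (g g' : ℝ → ℝ) (C : ℝ), (∀ t, HasDerivAt g (g' t) t) → g 0 = 0 →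
      ∀ y, (∀ t, |t| ≤ |y| → |g' t| ≤ C) → |g y| ≤ C * |y| := by
    intro g g' C hg h0 y hC
    have := Convex.norm_image_sub_le_of_norm_hasDerivWithin_le (𝕜 := ℝ) (f := g) (f' := g')
      (s := Metric.closedBall 0 |y|) (x := 0) (y := y) (C := C)
      (fun t _ => (hg t).hasDerivWithinAt) (fun t ht => hC t (by simpa using ht))
      (convex_closedBall _ _) (by simp) (by simp)
    simpa [h0] using this
  have e2 : ∀ t, |f₂ (x + t) - f₂ x| ≤ K * |t| := fun t =>
    key (fun t => f₂ (x + t) - f₂ x) (fun t => f₃ (x + t)) K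
      (fun t => ((h₃ (x + t)).comp_const_add x t).sub_const _) (by simp) t (fun s _ => hK _)
  have e1 : ∀ t, |f₁ (x + t) - f₁ x - f₂ x * t| ≤ K * |t| * |t| := fun t =>
    key (fun t => f₁ (x + t) - f₁ x - f₂ x * t) (fun t => f₂ (x + t) - f₂ x) (K * |t|)
      (fun t => by
        have := (((h₂ (x + t)).comp_const_add x t).sub_const (f₁ x)).fun_sub
          ((hasDerivAt_id' t).const_mul (f₂ x))
        exact this.congr_deriv (by ring)) (by simp) t
      (fun s hs => (e2 s).trans (by gcongr))
  have e0 := key (fun t => f (x + t) - f x - f₁ x * t - f₂ x * t ^ 2 / 2)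
      (fun t => f₁ (x + t) - f₁ x - f₂ x * t) (K * |y| * |y|)
      (fun t => by
        have := ((((h₁ (x + t)).comp_const_add x t).sub_const (f x)).fun_sub
          ((hasDerivAt_id' t).const_mul (f₁ x))).fun_sub
          ((((hasDerivAt_id' t).fun_pow 2).const_mul (f₂ x)).div_const 2)
        exact this.congr_deriv (by simp; ring)) (by simp) y
      (fun s hs => (e1 s).trans (by gcongr))
  calc _ ≤ K * |y| * |y| * |y| := e0
    _ = _ := by ring

lemma hasDerivAt_normalDensity (x : ℝ) :
    HasDerivAt normalDensity (-x * normalDensity x) x := by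
  have := ((((hasDerivAt_id' x).fun_pow 2).fun_neg.div_const 2).exp).const_mul (Real.sqrt (2 * π))⁻¹
  exact this.congr_deriv (by simp [normalDensity]; ring)

lemma abs_Phi_taylor_le (x y : ℝ) :
    |Phi (x + y) - Phi x - normalDensity x * y - (-x * normalDensity x) * y ^ 2 / 2|
      ≤ 2 * |y| ^ 3 := by
  refine abs_taylor_two_le hasDerivAt_Phi hasDerivAt_normalDensity
    (f₃ := fun x => (x ^ 2 - 1) * normalDensity x) (fun x => ?_) (fun x => ?_) x y
  · exact ((hasDerivAt_id' x).fun_neg.fun_mul (hasDerivAt_normalDensity x)).congr_deriv (by ring)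
  · rw [abs_mul, abs_of_pos (normalDensity_pos x)]
    calc |x ^ 2 - 1| * normalDensity x ≤ (x ^ 2 + 2) * Real.exp (-x ^ 2 / 2) := by
          refine mul_le_mul (abs_le.2 ⟨by nlinarith [sq_nonneg x], by linarith⟩)
            (normalDensity_le_exp x) (normalDensity_pos x).le (by positivity)
      _ ≤ (2 * Real.exp (x ^ 2 / 2)) * Real.exp (-x ^ 2 / 2) := by
          gcongr; linarith [Real.add_one_le_exp (x ^ 2 / 2)]
      _ = 2 := by rw [mul_assoc, ← Real.exp_add]; ring_nf; simp

lemma integral_stdNormal (f : ℝ → ℝ) : ∫ x, f x ∂stdNormal = ∫ x, normalDensity x * f x := by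
  rw [stdNormal, integral_gaussianReal_eq_integral_smul one_ne_zero]
  simp [normalDensity_eq]

lemma integrable_pow_stdNormal (k : ℕ) : Integrable (fun x : ℝ => x ^ k) stdNormal := by
  rcases Nat.eq_zero_or_pos k with rfl | hk
  · simp
  · have h := (memLp_id_gaussianReal (μ := 0) (v := 1) (k : NNReal))
    have := h.integrable_norm_pow hk.ne'
    refine this.mono (by fun_prop) (Filter.Eventually.of_forall fun x => ?_)
    simp

lemma integral_sq_stdNormal : ∫ x, x ^ 2 ∂stdNormal = 1 := by
  have h := variance_fun_id_gaussianReal (μ := 0) (v := 1)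
  rw [show (fun x : ℝ => x) = id from rfl,
    variance_eq_sub (memLp_id_gaussianReal' 2 (by simp))] at h
  simpa [integral_id_gaussianReal] using h

lemma integral_pow_four_stdNormal : ∫ x, x ^ 4 ∂stdNormal = 3 := by
  have h : ∀ x : ℝ, normalDensity x * x ^ 4 =
      (fun t : ℝ => (Real.sqrt (2 * π))⁻¹ * (t ^ (4 : ℝ) * Real.exp (-(1 / 2) * t ^ (2 : ℝ)))) |x| := by
    intro x
    have h4 : |x| ^ (4 : ℝ) = x ^ 4 := by
      rw [show (4 : ℝ) = ((4 : ℕ) : ℝ) by norm_num, Real.rpow_natCast]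
      exact Even.pow_abs ⟨2, rfl⟩ x
    have h2 : |x| ^ (2 : ℝ) = x ^ 2 := by
      rw [Real.rpow_two, sq_abs]
    simp only [h4, h2, normalDensity]
    rw [show -x ^ 2 / 2 = -(1 / 2) * x ^ 2 by ring]
    ring
  rw [integral_stdNormal, integral_congr_ae (Filter.Eventually.of_forall h),
    integral_comp_abs (f := fun t : ℝ => (Real.sqrt (2 * π))⁻¹ * (t ^ (4 : ℝ) * Real.exp (-(1 / 2) * t ^ (2 : ℝ)))),
    integral_const_mul, integral_rpow_mul_exp_neg_mul_rpow (by norm_num) (by norm_num)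
      (by norm_num)]
  have hG : Gamma ((4 + 1) / 2) = 3 * √π / 4 := by
    have := Real.Gamma_nat_add_half 2
    norm_num [Nat.doubleFactorial] at this ⊢
    exact this
  have hp : (1 / 2 : ℝ) ^ (-(4 + 1) / 2 : ℝ) = 4 * √2 := by
    rw [one_div, Real.inv_rpow (by norm_num), ← Real.rpow_neg (by norm_num),
      show (-(-(4 + 1) / 2) : ℝ) = 2 + 1 / 2 by norm_num, Real.rpow_add (by norm_num),
      ← Real.sqrt_eq_rpow]
    norm_num
  rw [hG, hp, Real.sqrt_mul (by norm_num)]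
  have h1 : √2 ≠ 0 := by positivity
  have h2 : √π ≠ 0 := by positivity
  field_simp

lemma integral_Phi_add_mul (b c : ℝ) :
    ∫ z, Phi (b + c * z) ∂stdNormal = Phi (b / √(1 + c ^ 2)) := by
  have hpos : 0 < √(1 + c ^ 2) := by positivity
  have hc : ((stdNormal.map (fun z => -c * z)) ∗ stdNormal) =
      stdNormal.map (fun z => √(1 + c ^ 2) * z) := by
    rw [gaussianReal_map_const_mul, gaussianReal_map_const_mul, gaussianReal_conv_gaussianReal]
    congr 1
    · simp
    · ext
      simp [Real.sq_sqrt (show 0 ≤ 1 + c ^ 2 by positivity)]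
      ring
  have h1 : ((stdNormal.map (fun z => -c * z)) ∗ stdNormal) (Set.Iic b) =
      ∫⁻ z, ENNReal.ofReal (Phi (b + c * z)) ∂stdNormal := by
    rw [Measure.conv, Measure.map_apply (by fun_prop) measurableSet_Iic,
      Measure.prod_apply ((by fun_prop : Measurable fun p : ℝ × ℝ => p.1 + p.2) measurableSet_Iic),
      lintegral_map (measurable_measure_prodMk_left
        ((by fun_prop : Measurable fun p : ℝ × ℝ => p.1 + p.2) measurableSet_Iic)) (by fun_prop)]
    refine lintegral_congr fun z => ?_
    rw [ofReal_Phi]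
    congr 1
    ext g
    simp only [Set.mem_preimage, Set.mem_Iic]
    constructor <;> intro h <;> linarith
  have h2 : (stdNormal.map (fun z => √(1 + c ^ 2) * z)) (Set.Iic b) =
      ENNReal.ofReal (Phi (b / √(1 + c ^ 2))) := by
    rw [Measure.map_apply (by fun_prop) measurableSet_Iic, ofReal_Phi]
    congr 1
    ext g
    simp only [Set.mem_preimage, Set.mem_Iic]
    rw [le_div_iff₀ hpos, mul_comm]
  rw [integral_eq_lintegral_of_nonneg_ae (Filter.Eventually.of_forall fun z => Phi_nonneg _)
    (by have := continuous_Phi; exact (by fun_prop : Continuous fun z => Phi (b + c * z)).aestronglyMeasurable),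
    ← h1, hc, h2, ENNReal.toReal_ofReal (Phi_nonneg _)]

lemma integrable_Phi_comp {α : Type*} [MeasurableSpace α] {μ : Measure α} [IsFiniteMeasure μ]
    {f : α → ℝ} (hf : Measurable f) : Integrable (fun z => Phi (f z)) μ :=
  Integrable.of_bound (continuous_Phi.measurable.comp hf).aestronglyMeasurable 1
    (Filter.Eventually.of_forall fun z => by
      rw [Real.norm_eq_abs, abs_of_nonneg (Phi_nonneg _)]; exact Phi_le_one _)

/-- Second-order expansion of a smoothed probability under a perturbation with mean zero and
variance two. -/
lemma abs_integral_Phi_sub_le {u : ℝ → ℝ} (hm : Measurable u)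
    (h₁ : Integrable u stdNormal) (h₂ : Integrable (fun z => u z ^ 2) stdNormal)
    (h₃ : Integrable (fun z => |u z| ^ 3) stdNormal)
    (hu₁ : ∫ z, u z ∂stdNormal = 0) (hu₂ : ∫ z, u z ^ 2 ∂stdNormal = 2) (x : ℝ) {s : ℝ}
    (hs : 0 ≤ s) :
    |∫ z, Phi (x + s * u z) ∂stdNormal - Phi x + x * normalDensity x * s ^ 2|
      ≤ 2 * (∫ z, |u z| ^ 3 ∂stdNormal) * s ^ 3 := by
  have hP : Integrable (fun z => Phi (x + s * u z)) stdNormal := integrable_Phi_comp (by fun_prop)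
  have e : ∫ z, Phi (x + s * u z) ∂stdNormal - Phi x + x * normalDensity x * s ^ 2 =
      ∫ z, (Phi (x + s * u z) - Phi x - normalDensity x * (s * u z)
        - (-x * normalDensity x) * (s * u z) ^ 2 / 2) ∂stdNormal := by
    have e1 : ∀ z, (Phi (x + s * u z) - Phi x - normalDensity x * (s * u z)
        - (-x * normalDensity x) * (s * u z) ^ 2 / 2) =
        (Phi (x + s * u z) - Phi x - (normalDensity x * s) * u z)
        - (-x * normalDensity x * s ^ 2 / 2) * u z ^ 2 := fun z => by ring
    simp_rw [e1]
    have hP' : Integrable (fun z => Phi (x + s * u z) - Phi x) stdNormal :=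
      hP.sub (integrable_const _)
    have hP'' : Integrable (fun z => Phi (x + s * u z) - Phi x - (normalDensity x * s) * u z)
        stdNormal := hP'.sub (h₁.const_mul _)
    rw [integral_sub hP'' (h₂.const_mul _), integral_sub hP' (h₁.const_mul _), integral_sub hP (integrable_const _), integral_const_mul, integral_const_mul, hu₁, hu₂]
    simp
  rw [e, ← Real.norm_eq_abs]
  calc _ ≤ ∫ z, 2 * s ^ 3 * |u z| ^ 3 ∂stdNormal := by
        refine norm_integral_le_of_norm_le (h₃.const_mul _) (Filter.Eventually.of_forall fun z => ?_)
        refine (abs_Phi_taylor_le x (s * u z)).trans_eq ?_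
        rw [abs_mul, abs_of_nonneg hs]; ring
    _ = _ := by rw [integral_const_mul]; ring

lemma integrable_sq_sub_one_pow (k : ℕ) :
    Integrable (fun z : ℝ => (z ^ 2 - 1) ^ k) stdNormal := by
  have h : ∀ z : ℝ, (z ^ 2 - 1) ^ k =
      ∑ i ∈ Finset.range (k + 1), z ^ (2 * i) * ((-1) ^ (k - i) * (k.choose i)) := fun z => by
    rw [sub_eq_add_neg, add_pow]
    exact Finset.sum_congr rfl fun i _ => by rw [← pow_mul, mul_assoc]
  simp_rw [h]
  exact integrable_finsetSum _ fun i _ => (integrable_pow_stdNormal _).mul_const _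

/-- One step of Lindeberg replacement of a centred chi-squared variable by a normal one. -/
lemma exists_integral_Phi_le : ∃ K : ℝ, 0 ≤ K ∧ ∀ σ h x : ℝ, 1 ≤ σ → 0 ≤ h →
    ∫ z, Phi ((x + h * (z ^ 2 - 1)) / σ) ∂stdNormal ≤
      Phi (x / √(σ ^ 2 + 2 * h ^ 2)) + K * h ^ 3 := by
  set A := ∫ z : ℝ, |z ^ 2 - 1| ^ 3 ∂stdNormal with hA
  set B := ∫ z : ℝ, |√2 * z| ^ 3 ∂stdNormal with hB
  have hA0 : 0 ≤ A := integral_nonneg fun z => by positivity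
  have hB0 : 0 ≤ B := integral_nonneg fun z => by positivity
  refine ⟨2 * A + 2 * B, by positivity, fun σ h x hσ hh => ?_⟩
  have hσ0 : 0 < σ := by linarith
  have hs : 0 ≤ h / σ := by positivity
  have i1 : ∫ z : ℝ, (z ^ 2 - 1) ∂stdNormal = 0 := by
    rw [integral_sub (integrable_pow_stdNormal 2) (integrable_const _), integral_sq_stdNormal]
    simp
  have i2 : ∫ z : ℝ, (z ^ 2 - 1) ^ 2 ∂stdNormal = 2 := by
    have : ∀ z : ℝ, (z ^ 2 - 1) ^ 2 = z ^ 4 - 2 * z ^ 2 + 1 := fun z => by ring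
    simp_rw [this]
    have h42 : Integrable (fun z : ℝ => z ^ 4 - 2 * z ^ 2) stdNormal :=
      (integrable_pow_stdNormal 4).sub ((integrable_pow_stdNormal 2).const_mul 2)
    rw [integral_add h42 (integrable_const _), integral_sub (integrable_pow_stdNormal 4)
      ((integrable_pow_stdNormal 2).const_mul 2), integral_const_mul, integral_sq_stdNormal,
      integral_pow_four_stdNormal]
    simp; norm_num
  have T1 := abs_integral_Phi_sub_le (u := fun z => z ^ 2 - 1) (by fun_prop)
    (by simpa using integrable_sq_sub_one_pow 1) (integrable_sq_sub_one_pow 2)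
    (by simpa [abs_pow] using (integrable_sq_sub_one_pow 3).abs) i1 i2 (x / σ) hs
  have T2 := abs_integral_Phi_sub_le (u := fun z => √2 * z) (by fun_prop)
    (by simpa using (integrable_pow_stdNormal 1).const_mul √2)
    (by simpa [mul_pow] using (integrable_pow_stdNormal 2).const_mul 2)
    (by simpa [mul_pow, abs_mul, abs_pow] using
      (integrable_pow_stdNormal 3).abs.const_mul (|√2| ^ 3))
    (by rw [integral_const_mul]; simp [integral_id_gaussianReal])
    (by simp_rw [mul_pow]; rw [integral_const_mul, integral_sq_stdNormal]; norm_num) (x / σ) hs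
  have e2 : ∫ z, Phi (x / σ + h / σ * (√2 * z)) ∂stdNormal = Phi (x / √(σ ^ 2 + 2 * h ^ 2)) := by
    simp_rw [← mul_assoc]
    rw [integral_Phi_add_mul]
    congr 1
    rw [div_div]
    congr 1
    rw [show σ ^ 2 + 2 * h ^ 2 = σ ^ 2 * (1 + (h / σ * √2) ^ 2) by
      rw [mul_pow, Real.sq_sqrt (by norm_num)]; field_simp]
    rw [Real.sqrt_mul (by positivity), Real.sqrt_sq hσ0.le]
  have e1 : ∀ z : ℝ, Phi ((x + h * (z ^ 2 - 1)) / σ) = Phi (x / σ + h / σ * (z ^ 2 - 1)) :=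
    fun z => by congr 1; ring
  rw [e2] at T2
  simp_rw [e1]
  have hle : (h / σ) ^ 3 ≤ h ^ 3 := pow_le_pow_left₀ hs (div_le_self hh hσ) 3
  have b1 := (abs_le.1 T1).2
  have b2 := (abs_le.1 T2).1
  simp only [← hA, ← hB] at b1 b2
  nlinarith [mul_le_mul_of_nonneg_left hle hA0, mul_le_mul_of_nonneg_left hle hB0]

lemma stdNormal_Ici_le {a : ℝ} (ha : 0 < a) :
    stdNormal (Set.Ici a) ≤ ENNReal.ofReal (Real.exp (-a ^ 2 / 2) / a) := by
  have hint : IntegrableOn (fun x => Real.exp (a ^ 2 / 2) * Real.exp (-a * x)) (Set.Ioi a) :=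
    (integrableOn_exp_mul_Ioi (by linarith) a).const_mul _
  rw [stdNormal, gaussianReal_apply_eq_integral 0 one_ne_zero, integral_Ici_eq_integral_Ioi]
  refine ENNReal.ofReal_le_ofReal ?_
  calc _ ≤ ∫ x in Set.Ioi a, Real.exp (a ^ 2 / 2) * Real.exp (-a * x) := by
        refine setIntegral_mono (integrable_gaussianPDFReal 0 1).integrableOn hint fun x => ?_
        rw [← normalDensity_eq, ← Real.exp_add]
        exact (normalDensity_le_exp x).trans (Real.exp_le_exp.2 (by nlinarith [sq_nonneg (x - a)]))
    _ = _ := by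
        rw [integral_const_mul, integral_exp_mul_Ioi (by linarith), neg_div_neg_eq, mul_div_assoc',
          ← Real.exp_add]
        congr 2; ring

lemma lintegral_exp_neg_sq_stdNormal {s : ℝ} (hs : 0 ≤ s) :
    ∫⁻ z, ENNReal.ofReal (Real.exp (-s * z ^ 2 / 2)) ∂stdNormal =
      ENNReal.ofReal ((√(1 + s))⁻¹) := by
  have hint : Integrable (fun z : ℝ => Real.exp (-s * z ^ 2 / 2)) stdNormal :=
    Integrable.of_bound (by fun_prop) 1 (Filter.Eventually.of_forall fun z => by
      rw [Real.norm_eq_abs, Real.abs_exp]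
      exact Real.exp_le_one_iff.2 (by nlinarith [mul_nonneg hs (sq_nonneg z)]))
  rw [← ofReal_integral_eq_lintegral_ofReal hint
    (Filter.Eventually.of_forall fun z => (Real.exp_pos _).le), integral_stdNormal]
  congr 1
  have : ∀ z, normalDensity z * Real.exp (-s * z ^ 2 / 2) =
      (√(2 * π))⁻¹ * Real.exp (-((1 + s) / 2) * z ^ 2) := fun z => by
    rw [normalDensity, mul_assoc, ← Real.exp_add]; ring_nf
  simp_rw [this]
  rw [integral_const_mul, integral_gaussian, show π / ((1 + s) / 2) = (2 * π) / (1 + s) by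
    field_simp, Real.sqrt_div (by positivity)]
  field_simp

/-- The law of a vector of `n` independent standard normal variables. -/
abbrev gaussVec (n : ℕ) : Measure (Fin n → ℝ) := Measure.pi fun _ : Fin n => stdNormal

lemma measurePreserving_cons (m : ℕ) :
    MeasurePreserving (fun p : ℝ × (Fin m → ℝ) => (Fin.cons p.1 p.2 : Fin (m + 1) → ℝ))
      (stdNormal.prod (gaussVec m)) (gaussVec (m + 1)) := by
  have := (measurePreserving_piFinSuccAbove (fun _ : Fin (m + 1) => stdNormal) 0).symm
  convert this using 1
  funext p
  simp [MeasurableEquiv.piFinSuccAbove, Fin.insertNthEquiv]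

lemma lintegral_gaussVec_succ {m : ℕ} {F : (Fin (m + 1) → ℝ) → ℝ≥0∞} (hF : Measurable F) :
    ∫⁻ z, F z ∂gaussVec (m + 1) =
      ∫⁻ t, ∫⁻ w, F (Fin.cons t w) ∂gaussVec m ∂stdNormal := by
  rw [← (measurePreserving_cons m).lintegral_comp hF,
    lintegral_prod (fun p : ℝ × (Fin m → ℝ) => F (Fin.cons p.1 p.2))
      (hF.comp (measurePreserving_cons m).measurable).aemeasurable]

lemma integral_gaussVec_succ {m : ℕ} {F : (Fin (m + 1) → ℝ) → ℝ}
    (hF : Integrable F (gaussVec (m + 1))) :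
    ∫ z, F z ∂gaussVec (m + 1) =
      ∫ w, ∫ t, F (Fin.cons t w) ∂stdNormal ∂gaussVec m := by
  rw [← integral_prod_symm (fun p : ℝ × (Fin m → ℝ) => F (Fin.cons p.1 p.2))
      ((measurePreserving_cons m).integrable_comp_of_integrable hF),
    ← (measurePreserving_cons m).map_eq, integral_map (measurePreserving_cons m).aemeasurable
      ((measurePreserving_cons m).map_eq ▸ hF.aestronglyMeasurable)]

lemma cons_dotProduct_self {m : ℕ} (t : ℝ) (w : Fin m → ℝ) :
    (Fin.cons t w : Fin (m + 1) → ℝ) ⬝ᵥ (Fin.cons t w : Fin (m + 1) → ℝ) = t ^ 2 + w ⬝ᵥ w := by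
  simp [dotProduct, Fin.sum_univ_succ, sq]

lemma dotProduct_self_nonneg' {n : ℕ} (w : Fin n → ℝ) : 0 ≤ w ⬝ᵥ w :=
  Finset.sum_nonneg fun _ _ => mul_self_nonneg _

@[fun_prop]
lemma measurable_dotProduct {α : Type*} [MeasurableSpace α] {n : ℕ} {f g : α → Fin n → ℝ}
    (hf : Measurable f) (hg : Measurable g) : Measurable fun a => f a ⬝ᵥ g a := by
  unfold dotProduct
  exact Finset.measurable_sum _ fun i _ =>
    ((measurable_pi_apply i).comp hf).mul ((measurable_pi_apply i).comp hg)

/-- The law of the projection on a unit vector and of the squared norm of a standard Gaussian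
vector does not depend on the unit vector. -/
lemma lintegral_dotProduct_gaussVec {m : ℕ} {u : Fin (m + 1) → ℝ} (hu : u ⬝ᵥ u = 1)
    {F : ℝ × ℝ → ℝ≥0∞} (hF : Measurable F) :
    ∫⁻ z, F (u ⬝ᵥ z, z ⬝ᵥ z) ∂gaussVec (m + 1) =
      ∫⁻ t, ∫⁻ w, F (t, t ^ 2 + w ⬝ᵥ w) ∂gaussVec m ∂stdNormal := by
  let E := EuclideanSpace ℝ (Fin (m + 1))
  let u' : E := WithLp.toLp 2 u
  have hin : ∀ x y : Fin (m + 1) → ℝ, inner ℝ (WithLp.toLp 2 x : E) (WithLp.toLp 2 y) = x ⬝ᵥ y := by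
    intro x y
    simp [PiLp.inner_apply, dotProduct, mul_comm]
  have hnorm : ‖u'‖ = 1 := by
    have : ‖u'‖ ^ 2 = 1 := by rw [← real_inner_self_eq_norm_sq, hin, hu]
    nlinarith [norm_nonneg u']
  obtain ⟨b, hb⟩ := Orthonormal.exists_orthonormalBasis_extension_of_card_eq (𝕜 := ℝ) (E := E)
    (ι := Fin (m + 1)) (by simp [E]) (v := fun _ => u') (s := {0})
    ⟨fun _ => hnorm, fun i j hij => absurd (Subsingleton.elim i j) hij⟩
  have hb0 : b 0 = u' := hb 0 rfl
  have hmeas : Measurable fun e : E => F (inner ℝ u' e, ‖e‖ ^ 2) := by fun_prop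
  have hsum : Measurable fun x : Fin (m + 1) → ℝ => ∑ i, x i • b i := by fun_prop
  calc ∫⁻ z, F (u ⬝ᵥ z, z ⬝ᵥ z) ∂gaussVec (m + 1)
      = ∫⁻ e, F (inner ℝ u' e, ‖e‖ ^ 2) ∂stdGaussian E := by
        rw [← map_pi_eq_stdGaussian, lintegral_map hmeas (by fun_prop)]
        refine lintegral_congr fun z => ?_
        rw [← real_inner_self_eq_norm_sq, hin, hin]
    _ = ∫⁻ x, F (x 0, x ⬝ᵥ x) ∂gaussVec (m + 1) := by
        rw [stdGaussian_eq_map_pi_orthonormalBasis b, lintegral_map hmeas hsum]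
        refine lintegral_congr fun x => ?_
        congr 2
        · rw [← hb0, b.orthonormal.inner_right_fintype]
        · rw [← real_inner_self_eq_norm_sq, b.orthonormal.inner_sum]
          simp [dotProduct]
    _ = _ := by
        rw [lintegral_gaussVec_succ (by fun_prop)]
        simp [cons_dotProduct_self]

lemma lintegral_exp_neg_gaussVec (m : ℕ) {s : ℝ} (hs : 0 ≤ s) :
    ∫⁻ w, ENNReal.ofReal (Real.exp (-s * (w ⬝ᵥ w) / 2)) ∂gaussVec m =
      ENNReal.ofReal ((1 + s) ^ (-(m : ℝ) / 2)) := by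
  induction m with
  | zero => simp
  | succ m ih =>
    rw [lintegral_gaussVec_succ (by fun_prop)]
    have : ∀ (t : ℝ) (w : Fin m → ℝ), ENNReal.ofReal (Real.exp (-s *
        ((Fin.cons t w : Fin (m + 1) → ℝ) ⬝ᵥ (Fin.cons t w : Fin (m + 1) → ℝ)) / 2)) =
        ENNReal.ofReal (Real.exp (-s * t ^ 2 / 2)) *
          ENNReal.ofReal (Real.exp (-s * (w ⬝ᵥ w) / 2)) := fun t w => by
      rw [cons_dotProduct_self, ← ENNReal.ofReal_mul (Real.exp_pos _).le, ← Real.exp_add]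
      ring_nf
    simp_rw [this]
    simp_rw [lintegral_const_mul' _ _ ENNReal.ofReal_ne_top, ih,
      lintegral_mul_const' _ _ ENNReal.ofReal_ne_top]
    rw [lintegral_exp_neg_sq_stdNormal hs, ← ENNReal.ofReal_mul (by positivity)]
    congr 1
    rw [Real.sqrt_eq_rpow, ← Real.rpow_neg (by positivity), ← Real.rpow_add (by positivity)]
    congr 1
    push_cast; ring

lemma exists_integral_Phi_gaussVec_le : ∃ K : ℝ, 0 ≤ K ∧ ∀ (m : ℕ) (h x : ℝ), 0 ≤ h →
    ∫ w, Phi (x + h * (w ⬝ᵥ w - m)) ∂gaussVec m ≤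
      Phi (x / √(1 + 2 * m * h ^ 2)) + m * (K * h ^ 3) := by
  obtain ⟨K, hK0, hK⟩ := exists_integral_Phi_le
  refine ⟨K, hK0, fun m h x hh => ?_⟩
  suffices H : ∀ σ : ℝ, 1 ≤ σ → ∫ w, Phi ((x + h * (w ⬝ᵥ w - m)) / σ) ∂gaussVec m ≤
      Phi (x / √(σ ^ 2 + 2 * m * h ^ 2)) + m * (K * h ^ 3) by
    simpa using H 1 le_rfl
  induction m with
  | zero => intro σ hσ; simp [Real.sqrt_sq (show 0 ≤ σ by linarith)]
  | succ m ih =>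
    intro σ hσ
    rw [integral_gaussVec_succ (integrable_Phi_comp (by fun_prop))]
    have hσ' : 1 ≤ √(σ ^ 2 + 2 * h ^ 2) := Real.one_le_sqrt.2 (by nlinarith [sq_nonneg h])
    have step : ∀ w : Fin m → ℝ,
        ∫ t, Phi ((x + h * ((Fin.cons t w : Fin (m + 1) → ℝ) ⬝ᵥ (Fin.cons t w : Fin (m + 1) → ℝ)
          - ((m + 1 : ℕ) : ℝ))) / σ) ∂stdNormal ≤
        Phi ((x + h * (w ⬝ᵥ w - m)) / √(σ ^ 2 + 2 * h ^ 2)) + K * h ^ 3 := fun w => by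
      refine le_trans (le_of_eq ?_) (hK σ h (x + h * (w ⬝ᵥ w - m)) hσ hh)
      refine integral_congr_ae (Filter.Eventually.of_forall fun t => ?_)
      simp only [cons_dotProduct_self]
      congr 2
      push_cast; ring
    calc _ ≤ ∫ w, (Phi ((x + h * (w ⬝ᵥ w - m)) / √(σ ^ 2 + 2 * h ^ 2)) + K * h ^ 3)
          ∂gaussVec m := by
          refine integral_mono_of_nonneg
            (Filter.Eventually.of_forall fun w => integral_nonneg fun t => Phi_nonneg _)
            ((integrable_Phi_comp (by fun_prop)).add (integrable_const _))
            (Filter.Eventually.of_forall step)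
      _ = ∫ w, Phi ((x + h * (w ⬝ᵥ w - m)) / √(σ ^ 2 + 2 * h ^ 2)) ∂gaussVec m + K * h ^ 3 := by
          rw [integral_add (integrable_Phi_comp (by fun_prop)) (integrable_const _)]
          simp
      _ ≤ Phi (x / √(√(σ ^ 2 + 2 * h ^ 2) ^ 2 + 2 * m * h ^ 2)) + m * (K * h ^ 3) + K * h ^ 3 := by
          gcongr; exact ih _ hσ'
      _ = _ := by
          rw [Real.sq_sqrt (by positivity)]
          push_cast
          rw [show σ ^ 2 + 2 * h ^ 2 + 2 * m * h ^ 2 = σ ^ 2 + 2 * ((m : ℝ) + 1) * h ^ 2 by ring]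
          ring

lemma lintegral_dotProduct_self_gaussVec (m : ℕ) :
    ∫⁻ w, ENNReal.ofReal (w ⬝ᵥ w) ∂gaussVec m = m := by
  have h1 : ∫⁻ t : ℝ, ENNReal.ofReal (t * t) ∂stdNormal = 1 := by
    have := integral_sq_stdNormal
    rw [integral_eq_lintegral_of_nonneg_ae (Filter.Eventually.of_forall fun z => sq_nonneg z)
      (by fun_prop)] at this
    simp_rw [← sq]
    exact (ENNReal.toReal_eq_one_iff _).1 this
  have : ∀ w : Fin m → ℝ, ENNReal.ofReal (w ⬝ᵥ w) = ∑ i, ENNReal.ofReal (w i * w i) := fun w =>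
    ENNReal.ofReal_sum_of_nonneg fun i _ => mul_self_nonneg _
  simp_rw [this]
  rw [lintegral_finsetSum _ (fun i _ => by fun_prop)]
  have : ∀ i : Fin m, ∫⁻ w, ENNReal.ofReal (w i * w i) ∂gaussVec m = 1 := fun i => by
    rw [← h1, ← (measurePreserving_eval (fun _ : Fin m => stdNormal) i).lintegral_comp
      (by fun_prop)]
  simp [this]

lemma lintegral_norm_gaussVec_le {m : ℕ} (hm : 0 < m) :
    ∫⁻ w, ENNReal.ofReal (√(w ⬝ᵥ w)) ∂gaussVec m ≤ ENNReal.ofReal √m := by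
  have hm' : 0 < √(m : ℝ) := by positivity
  calc _ ≤ ∫⁻ w, (ENNReal.ofReal (√m / 2) +
        ENNReal.ofReal (1 / (2 * √m)) * ENNReal.ofReal (w ⬝ᵥ w)) ∂gaussVec m := by
        refine lintegral_mono fun w => ?_
        have hw := dotProduct_self_nonneg' w
        rw [← ENNReal.ofReal_mul (by positivity), ← ENNReal.ofReal_add (by positivity)
          (by positivity)]
        refine ENNReal.ofReal_le_ofReal ?_
        have e : √(m : ℝ) / 2 + 1 / (2 * √m) * (w ⬝ᵥ w) - √(w ⬝ᵥ w) =
            (√(w ⬝ᵥ w) - √m) ^ 2 / (2 * √m) := by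
          field_simp
          nlinarith [Real.sq_sqrt hw, Real.sq_sqrt (Nat.cast_nonneg (α := ℝ) m)]
        have : 0 ≤ (√(w ⬝ᵥ w) - √m) ^ 2 / (2 * √m) := by positivity
        linarith
    _ = ENNReal.ofReal (√m / 2) + ENNReal.ofReal (1 / (2 * √m)) * m := by
        rw [lintegral_add_left (by fun_prop), lintegral_const_mul' _ _ ENNReal.ofReal_ne_top,
          lintegral_dotProduct_self_gaussVec]
        simp
    _ = _ := by
        rw [← ENNReal.ofReal_natCast, ← ENNReal.ofReal_mul (by positivity),
          ← ENNReal.ofReal_add (by positivity) (by positivity)]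
        congr 1
        field_simp
        nlinarith [Real.sq_sqrt (Nat.cast_nonneg (α := ℝ) m)]

lemma lintegral_exp_neg_div_sq_gaussVec_le {m : ℕ} (hm : 2 < m) {c : ℝ} (hc : 1 ≤ c) :
    ∫⁻ w, ENNReal.ofReal (Real.exp (-(c - 1) * (w ⬝ᵥ w) / 2) / (w ⬝ᵥ w)) ∂gaussVec m ≤
      ENNReal.ofReal (c ^ (1 - (m : ℝ) / 2) / (m - 2)) := by
  have hm' : (2 : ℝ) < m := by exact_mod_cast hm
  calc _ ≤ ∫⁻ w, (∫⁻ v in Set.Ioi c, ENNReal.ofReal (1 / 2) *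
        ENNReal.ofReal (Real.exp (-(v - 1) * (w ⬝ᵥ w) / 2))) ∂gaussVec m := by
        refine lintegral_mono fun w => ?_
        rcases (dotProduct_self_nonneg' w).eq_or_lt with h0 | h0
        · simp [← h0]
        set r := w ⬝ᵥ w
        have e : ∀ v : ℝ, ENNReal.ofReal (1 / 2) * ENNReal.ofReal (Real.exp (-(v - 1) * r / 2)) =
            ENNReal.ofReal (1 / 2 * Real.exp (r / 2) * Real.exp (-(r / 2) * v)) := fun v => by
          rw [← ENNReal.ofReal_mul (by norm_num), mul_assoc, ← Real.exp_add]
          ring_nf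
        simp_rw [e]
        rw [← ofReal_integral_eq_lintegral_ofReal
          ((integrableOn_exp_mul_Ioi (by linarith) c).const_mul _)
          (Filter.Eventually.of_forall fun v => by positivity), integral_const_mul,
          integral_exp_mul_Ioi (by linarith)]
        refine ENNReal.ofReal_le_ofReal (le_of_eq ?_)
        rw [neg_div_neg_eq, mul_div_assoc', mul_assoc, ← Real.exp_add]
        field_simp
        ring_nf
    _ = ∫⁻ v in Set.Ioi c, (∫⁻ w, ENNReal.ofReal (1 / 2) *
        ENNReal.ofReal (Real.exp (-(v - 1) * (w ⬝ᵥ w) / 2)) ∂gaussVec m) := by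
        rw [lintegral_lintegral_swap]
        exact Measurable.aemeasurable (by fun_prop)
    _ = ∫⁻ v in Set.Ioi c, ENNReal.ofReal (1 / 2 * v ^ (-(m : ℝ) / 2)) := by
        refine setLIntegral_congr_fun measurableSet_Ioi fun v hv => ?_
        have hv' : c < v := hv
        rw [lintegral_const_mul' _ _ ENNReal.ofReal_ne_top,
          lintegral_exp_neg_gaussVec m (by linarith), ← ENNReal.ofReal_mul (by norm_num)]
        simp
    _ = _ := by
        rw [← ofReal_integral_eq_lintegral_ofReal
          ((integrableOn_Ioi_rpow_of_lt (by linarith) (by linarith)).const_mul _)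
          ((ae_restrict_iff' measurableSet_Ioi).2 (Filter.Eventually.of_forall fun v hv => by
            have hv' : c < v := hv
            have : 0 < v := by linarith
            change 0 ≤ 1 / 2 * v ^ (-(m : ℝ) / 2)
            positivity)), integral_const_mul, integral_Ioi_rpow_of_lt (by linarith) (by linarith)]
        congr 1
        rw [show -(m : ℝ) / 2 + 1 = 1 - m / 2 by ring]
        have : (m : ℝ) - 2 ≠ 0 := by linarith
        rw [show c ^ (1 - (m : ℝ) / 2) / (m - 2) =
          1 / 2 * (-c ^ (1 - (m : ℝ) / 2) / (-((m - 2) / 2))) by field_simp]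
        congr 3
        ring

lemma gaussVec_dotProduct_self_eq_zero {m : ℕ} (hm : 0 < m) :
    gaussVec m {w | w ⬝ᵥ w = 0} = 0 := by
  have : {w : Fin m → ℝ | w ⬝ᵥ w = 0} ⊆ (fun w => w ⟨0, hm⟩) ⁻¹' {0} := fun w hw => by
    have := dotProduct_self_eq_zero.1 (show w ⬝ᵥ w = 0 from hw)
    simp [this]
  refine measure_mono_null this ?_
  rw [(measurePreserving_eval (fun _ : Fin m => stdNormal) ⟨0, hm⟩).measure_preimage
    (measurableSet_singleton 0).nullMeasurableSet]
  exact gaussianReal_absolutelyContinuous 0 one_ne_zero (by simp)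

/-- A bound on the measure of a spherical cap, seen as the probability that the first coordinate
of a Gaussian vector exceeds `κ` times the norm of the remaining ones. -/
lemma lintegral_stdNormal_Ici_le {m : ℕ} (hm : 4 ≤ m) {κ : ℝ} (hκ : 0 < κ) :
    ∫⁻ w, stdNormal (Set.Ici (κ * √(w ⬝ᵥ w))) ∂gaussVec m ≤
      ENNReal.ofReal (√(1 + κ ^ 2) / κ * (1 + κ ^ 2) ^ (-(m : ℝ) / 2) * (2 / √m)) := by
  set c := 1 + κ ^ 2 with hc
  have hc1 : 1 ≤ c := by nlinarith [sq_nonneg κ]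
  have hc0 : 0 < c := by linarith
  have hm4 : (4 : ℝ) ≤ m := by exact_mod_cast hm
  have hms : 0 < √(m : ℝ) := by positivity
  set l := √(m : ℝ) / √c with hl
  have hl0 : 0 < l := by positivity
  have hae : ∀ᵐ w ∂gaussVec m, w ⬝ᵥ w ≠ 0 := by
    rw [ae_iff]; simpa using gaussVec_dotProduct_self_eq_zero (by omega : 0 < m)
  calc _ ≤ ∫⁻ w, (ENNReal.ofReal (l / (2 * κ)) *
          ENNReal.ofReal (Real.exp (-(c - 1) * (w ⬝ᵥ w) / 2) / (w ⬝ᵥ w)) +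
        ENNReal.ofReal (1 / (2 * κ * l)) *
          ENNReal.ofReal (Real.exp (-(c - 1) * (w ⬝ᵥ w) / 2))) ∂gaussVec m := by
        refine lintegral_mono_ae (hae.mono fun w hw => ?_)
        have hw0 : 0 < w ⬝ᵥ w := (dotProduct_self_nonneg' w).lt_of_ne' hw
        obtain ⟨r, hr, hr2⟩ : ∃ r : ℝ, 0 < r ∧ w ⬝ᵥ w = r ^ 2 :=
          ⟨√(w ⬝ᵥ w), by positivity, (Real.sq_sqrt hw0.le).symm⟩
        rw [hr2, Real.sqrt_sq hr.le]
        refine (stdNormal_Ici_le (by positivity)).trans ?_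
        rw [← ENNReal.ofReal_mul (by positivity), ← ENNReal.ofReal_mul (by positivity),
          ← ENNReal.ofReal_add (by positivity) (by positivity)]
        refine ENNReal.ofReal_le_ofReal ?_
        rw [show -(κ * r) ^ 2 / 2 = -(c - 1) * r ^ 2 / 2 by rw [hc]; ring]
        set e := Real.exp (-(c - 1) * r ^ 2 / 2)
        have he : 0 < e := Real.exp_pos _
        have : l / (2 * κ) * (e / r ^ 2) + 1 / (2 * κ * l) * e - e / (κ * r) =
            e * (l - r) ^ 2 / (2 * κ * l * r ^ 2) := by
          field_simp; ring
        have : 0 ≤ e * (l - r) ^ 2 / (2 * κ * l * r ^ 2) := by positivity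
        linarith
    _ ≤ ENNReal.ofReal (l / (2 * κ)) * ENNReal.ofReal (c ^ (1 - (m : ℝ) / 2) / (m - 2)) +
        ENNReal.ofReal (1 / (2 * κ * l)) * ENNReal.ofReal (c ^ (-(m : ℝ) / 2)) := by
        rw [lintegral_add_left (by fun_prop), lintegral_const_mul' _ _ ENNReal.ofReal_ne_top,
          lintegral_const_mul' _ _ ENNReal.ofReal_ne_top,
          lintegral_exp_neg_gaussVec m (by linarith), add_sub_cancel]
        gcongr
        exact lintegral_exp_neg_div_sq_gaussVec_le (by omega) hc1
    _ ≤ _ := by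
        have hm2 : 0 < (m : ℝ) - 2 := by linarith
        rw [← ENNReal.ofReal_mul (by positivity), ← ENNReal.ofReal_mul (by positivity),
          ← ENNReal.ofReal_add (by positivity) (by positivity)]
        refine ENNReal.ofReal_le_ofReal ?_
        rw [show 1 - (m : ℝ) / 2 = 1 + -(m : ℝ) / 2 by ring, Real.rpow_add hc0, Real.rpow_one]
        set q := c ^ (-(m : ℝ) / 2)
        have hq : 0 < q := Real.rpow_pos_of_pos hc0 _
        obtain ⟨s, hs, hs2⟩ : ∃ s : ℝ, √c = s ∧ c = s ^ 2 := ⟨_, rfl, (Real.sq_sqrt hc0.le).symm⟩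
        obtain ⟨p, hp, hp2⟩ : ∃ p : ℝ, √(m : ℝ) = p ∧ (m : ℝ) = p ^ 2 :=
          ⟨_, rfl, (Real.sq_sqrt (by linarith)).symm⟩
        have hs0 : 0 < s := by rw [← hs]; positivity
        have hp0 : 0 < p := by rw [← hp]; positivity
        rw [hl, hs, hp, hs2, hp2]
        rw [hp2] at hm2 hm4
        have e : s / κ * q * (2 / p) - (p / s / (2 * κ) * (s ^ 2 * q / (p ^ 2 - 2)) +
            1 / (2 * κ * (p / s)) * q) = s * q * (2 * p ^ 2 - 6) / (2 * κ * p * (p ^ 2 - 2)) := by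
          field_simp; ring
        have : 0 ≤ s * q * (2 * p ^ 2 - 6) / (2 * κ * p * (p ^ 2 - 2)) := by
          have : 0 ≤ 2 * p ^ 2 - 6 := by linarith
          positivity
        linarith

lemma stdNormal_le_volume : stdNormal ≤ volume := by
  rw [stdNormal, gaussianReal_of_var_ne_zero 0 one_ne_zero]
  calc volume.withDensity (gaussianPDF 0 1) ≤ volume.withDensity 1 := by
        refine withDensity_mono (Filter.Eventually.of_forall fun x => ?_)
        rw [gaussianPDF, ← normalDensity_eq]
        exact ENNReal.ofReal_le_one.2 (normalDensity_le_one x)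
    _ = volume := withDensity_one

lemma lintegral_Ioi_rpow_stdNormal_le {p a : ℝ} (hp : 1 < p) (ha : 0 < a) (t₀ : ℝ) :
    ∫⁻ t in Set.Ioi t₀, ENNReal.ofReal ((1 + a * (t - t₀)) ^ (-p)) ∂stdNormal ≤
      ENNReal.ofReal (1 / (a * (p - 1))) := by
  have hpos : ∀ t ∈ Set.Ici t₀, 0 < 1 + a * (t - t₀) := fun t ht => by
    have : 0 ≤ t - t₀ := sub_nonneg.2 ht
    positivity
  have hp' : p - 1 ≠ 0 := by linarith
  have hd : ∀ t ∈ Set.Ici t₀, HasDerivAt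
      (fun t => -(1 + a * (t - t₀)) ^ (-(p - 1)) / (a * (p - 1)))
      ((1 + a * (t - t₀)) ^ (-p)) t := fun t ht => by
    have h1 : HasDerivAt (fun t => 1 + a * (t - t₀)) a t := by
      simpa using (((hasDerivAt_id' t).sub_const t₀).const_mul a).const_add 1
    have := ((h1.rpow_const (p := -(p - 1)) (Or.inl (hpos t ht).ne')).fun_neg).div_const
      (a * (p - 1))
    refine this.congr_deriv ?_
    rw [show -(p - 1) - 1 = -p by ring]
    field_simp
  have hnn : ∀ t ∈ Set.Ioi t₀, 0 ≤ (1 + a * (t - t₀)) ^ (-p) := fun t ht =>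
    Real.rpow_nonneg (hpos t (Set.mem_Ici.2 (Set.mem_Ioi.1 ht).le)).le _
  have hlim : Filter.Tendsto (fun t => -(1 + a * (t - t₀)) ^ (-(p - 1)) / (a * (p - 1)))
      Filter.atTop (nhds 0) := by
    have h1 : Filter.Tendsto (fun t => 1 + a * (t - t₀)) Filter.atTop Filter.atTop :=
      Filter.tendsto_atTop_add_const_left _ _ ((Filter.tendsto_atTop_add_const_right _ _
        Filter.tendsto_id).const_mul_atTop ha)
    simpa using (((tendsto_rpow_neg_atTop (show 0 < p - 1 by linarith)).comp h1).neg).div_const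
      (a * (p - 1))
  have hint := integrableOn_Ioi_deriv_of_nonneg' hd hnn hlim
  have hval := integral_Ioi_of_hasDerivAt_of_nonneg' hd hnn hlim
  calc _ ≤ ∫⁻ t in Set.Ioi t₀, ENNReal.ofReal ((1 + a * (t - t₀)) ^ (-p)) :=
        lintegral_mono' (Measure.restrict_mono le_rfl stdNormal_le_volume) le_rfl
    _ = ENNReal.ofReal (∫ t in Set.Ioi t₀, (1 + a * (t - t₀)) ^ (-p)) :=
        (ofReal_integral_eq_lintegral_ofReal hint ((ae_restrict_iff' measurableSet_Ioi).2
          (Filter.Eventually.of_forall hnn))).symm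
    _ = _ := by
        rw [hval]
        simp [neg_div]

lemma map_pair_pi {α : Type*} [MeasurableSpace α] (μ : Measure α) [IsProbabilityMeasure μ] {M : ℕ}
    {i j : Fin M} (hij : i ≠ j) :
    (Measure.pi fun _ : Fin M => μ).map (fun G => (G i, G j)) = μ.prod μ := by
  have h := (iIndepFun_pi (μ := fun _ : Fin M => μ) (X := fun _ x => x)
    (fun _ => aemeasurable_id)).indepFun hij
  rw [indepFun_iff_map_prod_eq_prod_map_map (measurable_pi_apply i).aemeasurable
    (measurable_pi_apply j).aemeasurable] at h
  rw [h, (measurePreserving_eval (fun _ : Fin M => μ) i).map_eq,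
    (measurePreserving_eval (fun _ : Fin M => μ) j).map_eq]

/-- Random coding with maximum-correlation decoding: it suffices to control the probability of an
atypical event and, on its complement, the expected pairwise error probability. -/
lemma isCode_of_random_coding {n M : ℕ} {ε P : ℝ} (hM : 0 < M) (hε : 0 ≤ ε)
    {c : (Fin n → ℝ) → (Fin n → ℝ)} (hc : Measurable c) (hP : ∀ g, ∑ i, c g i ^ 2 ≤ n * P)
    {good : Set ((Fin n → ℝ) × (Fin n → ℝ))} (hgood : MeasurableSet good) {β η : ℝ≥0∞}
    (hβ : ∫⁻ g, gaussVec n {z | (c g, z) ∉ good} ∂gaussVec n ≤ β)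
    (hη : ∫⁻ p, gaussVec n {z | (c p.1, z) ∈ good ∧ c p.1 ⬝ᵥ (c p.1 + z) ≤ c p.2 ⬝ᵥ (c p.1 + z)}
      ∂((gaussVec n).prod (gaussVec n)) ≤ η)
    (hle : β + M * η ≤ ENNReal.ofReal ε) : IsCode n M ε P := by
  classical
  set b : (Fin n → ℝ) → ℝ≥0∞ := fun g => gaussVec n {z | (c g, z) ∉ good} with hb
  set q : (Fin n → ℝ) × (Fin n → ℝ) → ℝ≥0∞ := fun p =>
    gaussVec n {z | (c p.1, z) ∈ good ∧ c p.1 ⬝ᵥ (c p.1 + z) ≤ c p.2 ⬝ᵥ (c p.1 + z)} with hq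
  have hbm : Measurable b := by
    have : MeasurableSet {p : (Fin n → ℝ) × (Fin n → ℝ) | (c p.1, p.2) ∉ good} :=
      ((by fun_prop : Measurable fun p : (Fin n → ℝ) × (Fin n → ℝ) => (c p.1, p.2)) hgood).compl
    exact measurable_measure_prodMk_left this
  have hqm : Measurable q := by
    have hle : MeasurableSet {p : ((Fin n → ℝ) × (Fin n → ℝ)) × (Fin n → ℝ) |
        c p.1.1 ⬝ᵥ (c p.1.1 + p.2) ≤ c p.1.2 ⬝ᵥ (c p.1.1 + p.2)} :=
      measurableSet_le (by fun_prop) (by fun_prop)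
    have : MeasurableSet {p : ((Fin n → ℝ) × (Fin n → ℝ)) × (Fin n → ℝ) |
        (c p.1.1, p.2) ∈ good ∧ c p.1.1 ⬝ᵥ (c p.1.1 + p.2) ≤ c p.1.2 ⬝ᵥ (c p.1.1 + p.2)} :=
      ((by fun_prop : Measurable fun p : ((Fin n → ℝ) × (Fin n → ℝ)) × (Fin n → ℝ) =>
        (c p.1.1, p.2)) hgood).inter hle
    exact measurable_measure_prodMk_left this
  let f : (Fin M → Fin n → ℝ) → ℝ≥0∞ := fun G =>
    ∑ m, (b (G m) + ∑ m' ∈ Finset.univ.erase m, q (G m, G m'))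
  have hfm : Measurable f := by fun_prop
  obtain ⟨G, hG⟩ := exists_le_lintegral (μ := Measure.pi fun _ : Fin M => gaussVec n)
    hfm.aemeasurable
  have hfint : ∫⁻ G, f G ∂(Measure.pi fun _ : Fin M => gaussVec n) ≤
      ENNReal.ofReal (M * ε) := by
    have e1 : ∀ m : Fin M, ∫⁻ G, b (G m) ∂(Measure.pi fun _ : Fin M => gaussVec n) ≤ β :=
      fun m => by
        rw [(measurePreserving_eval (fun _ : Fin M => gaussVec n) m).lintegral_comp hbm]
        exact hβ
    have e2 : ∀ m m' : Fin M, m ≠ m' →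
        ∫⁻ G, q (G m, G m') ∂(Measure.pi fun _ : Fin M => gaussVec n) ≤ η := fun m m' h => by
      rw [← lintegral_map (f := q) (g := fun G : Fin M → Fin n → ℝ => (G m, G m')) hqm
        (by fun_prop), map_pair_pi _ h]
      exact hη
    calc _ = ∑ m, (∫⁻ G, b (G m) ∂(Measure.pi fun _ : Fin M => gaussVec n) +
          ∑ m' ∈ Finset.univ.erase m,
            ∫⁻ G, q (G m, G m') ∂(Measure.pi fun _ : Fin M => gaussVec n)) := by
          rw [lintegral_finsetSum _ (fun m _ => by fun_prop)]
          refine Finset.sum_congr rfl fun m _ => ?_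
          rw [lintegral_add_left (by fun_prop), lintegral_finsetSum _ (fun m _ => by fun_prop)]
      _ ≤ ∑ m : Fin M, (β + ∑ m' ∈ (Finset.univ : Finset (Fin M)).erase m, η) := by
          gcongr with m _ m' hm'
          · exact e1 m
          · exact e2 m m' (Finset.ne_of_mem_erase hm').symm
      _ ≤ ∑ m : Fin M, (β + M * η) := by
          gcongr with m
          rw [Finset.sum_const, nsmul_eq_mul]
          gcongr
          simp
      _ ≤ ∑ m : Fin M, ENNReal.ofReal ε := by gcongr
      _ = _ := by
          rw [ENNReal.ofReal_mul (by positivity)]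
          simp
  let x : Fin M → Fin n → ℝ := fun m => c (G m)
  let D : Fin M → Set (Fin n → ℝ) := fun m => ⋂ m' ∈ Finset.univ.erase m, {y | x m' ⬝ᵥ y < x m ⬝ᵥ y}
  have hW : ∀ m, Wn n (x m) (D m)ᶜ ≤ b (G m) + ∑ m' ∈ Finset.univ.erase m, q (G m, G m') := by
    intro m
    have hsub : {z : Fin n → ℝ | (fun i => x m i + z i) ∈ (D m)ᶜ} ⊆ {z | (c (G m), z) ∉ good} ∪
        ⋃ m' ∈ Finset.univ.erase m, {z | (c (G m), z) ∈ good ∧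
          c (G m) ⬝ᵥ (c (G m) + z) ≤ c (G m') ⬝ᵥ (c (G m) + z)} := by
      intro z hz
      by_cases hg : (c (G m), z) ∈ good
      · right
        simp only [D, Set.mem_ofPred_eq, Set.mem_compl_iff, Set.mem_iInter, not_forall, not_lt] at hz
        obtain ⟨m', hm', h⟩ := hz
        exact Set.mem_iUnion₂.2 ⟨m', hm', hg, h⟩
      · exact Or.inl hg
    refine (measure_mono hsub).trans ((measure_union_le _ _).trans ?_)
    gcongr
    exact measure_biUnion_finset_le _ _
  refine ⟨x, D, fun m => hP _, fun m => ?_, fun m m' h => ?_, ?_⟩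
  · exact Finset.measurableSet_biInter _ fun m' _ => measurableSet_lt (by fun_prop) (by fun_prop)
  · refine Set.disjoint_left.2 fun y hy hy' => ?_
    have h1 : x m' ⬝ᵥ y < x m ⬝ᵥ y := Set.mem_iInter₂.1 hy m' (Finset.mem_erase.2 ⟨h.symm, Finset.mem_univ _⟩)
    have h2 : x m ⬝ᵥ y < x m' ⬝ᵥ y := Set.mem_iInter₂.1 hy' m (Finset.mem_erase.2 ⟨h, Finset.mem_univ _⟩)
    exact lt_asymm h1 h2
  · have htop : ∀ m ∈ (Finset.univ : Finset (Fin M)), Wn n (x m) (D m)ᶜ ≠ ⊤ := fun m _ =>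
      measure_ne_top _ _
    rw [← ENNReal.toReal_sum htop]
    have hM' : (0 : ℝ) < M := by exact_mod_cast hM
    have : (∑ m, Wn n (x m) (D m)ᶜ).toReal ≤ M * ε :=
      ENNReal.toReal_le_of_le_ofReal (by positivity)
        ((Finset.sum_le_sum fun m _ => hW m).trans (hG.trans hfint))
    rw [one_div, inv_mul_le_iff₀ hM']
    exact this

/-- The radial projection of a vector onto the sphere of radius `ρ`. -/
def sphereProj {n : ℕ} (ρ : ℝ) (g : Fin n → ℝ) : Fin n → ℝ := (ρ / √(g ⬝ᵥ g)) • g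

@[fun_prop]
lemma measurable_sphereProj {n : ℕ} (ρ : ℝ) : Measurable (sphereProj (n := n) ρ) := by
  unfold sphereProj; fun_prop

lemma sphereProj_dotProduct_self_le {n : ℕ} (ρ : ℝ) (g : Fin n → ℝ) :
    sphereProj ρ g ⬝ᵥ sphereProj ρ g ≤ ρ ^ 2 := by
  rcases (dotProduct_self_nonneg' g).eq_or_lt with h | h
  · simp [sphereProj, ← h, sq_nonneg]
  · simp only [sphereProj, smul_dotProduct, dotProduct_smul, smul_eq_mul]
    refine le_of_eq ?_
    have h2 := Real.sq_sqrt h.le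
    have : √(g ⬝ᵥ g) ≠ 0 := by positivity
    field_simp
    rw [h2]

lemma exists_unit_sphereProj {n : ℕ} (ρ : ℝ) {g : Fin n → ℝ} (hg : g ⬝ᵥ g ≠ 0) :
    ∃ u : Fin n → ℝ, u ⬝ᵥ u = 1 ∧ g = √(g ⬝ᵥ g) • u ∧ sphereProj ρ g = ρ • u := by
  have h : 0 < g ⬝ᵥ g := (dotProduct_self_nonneg' g).lt_of_ne' hg
  have hs : √(g ⬝ᵥ g) ≠ 0 := by positivity
  refine ⟨(√(g ⬝ᵥ g))⁻¹ • g, ?_, ?_, ?_⟩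
  · simp only [smul_dotProduct, dotProduct_smul, smul_eq_mul]
    have h2 := Real.sq_sqrt h.le
    field_simp
    exact h2.symm
  · rw [smul_smul, mul_inv_cancel₀ hs, one_smul]
  · rw [sphereProj, smul_smul, div_eq_mul_inv]

lemma lintegral_orthogonal_gaussVec {m : ℕ} {u : Fin (m + 1) → ℝ} (hu : u ⬝ᵥ u = 1)
    {F : ℝ × ℝ → ℝ≥0∞} (hF : Measurable F) :
    ∫⁻ z, F (u ⬝ᵥ z, √(z ⬝ᵥ z - (u ⬝ᵥ z) ^ 2)) ∂gaussVec (m + 1) =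
      ∫⁻ w, ∫⁻ t, F (t, √(w ⬝ᵥ w)) ∂stdNormal ∂gaussVec m := by
  rw [lintegral_dotProduct_gaussVec (F := fun p => F (p.1, √(p.2 - p.1 ^ 2))) hu (by fun_prop)]
  simp only [add_sub_cancel_left]
  exact lintegral_lintegral_swap (by fun_prop)

lemma gaussVec_sphereProj_dotProduct_ge_le {m : ℕ} (hm : 4 ≤ m) {ρ A R : ℝ} (hρ : 0 < ρ)
    (hA : 0 < A) (hR : 0 < R) {y : Fin (m + 1) → ℝ} (hy : y ⬝ᵥ y = A ^ 2 + R ^ 2) :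
    gaussVec (m + 1) {g | ρ * A ≤ sphereProj ρ g ⬝ᵥ y} ≤
      ENNReal.ofReal (√(1 + (A / R) ^ 2) / (A / R) * (1 + (A / R) ^ 2) ^ (-(m : ℝ) / 2) *
        (2 / √m)) := by
  set κ := A / R with hκ
  have hκ0 : 0 < κ := by positivity
  have hyy : 0 < A ^ 2 + R ^ 2 := by positivity
  obtain ⟨v, hv, hyv, -⟩ := exists_unit_sphereProj ρ (g := y) (by rw [hy]; exact hyy.ne')
  set S : Set (ℝ × ℝ) := {p | κ * p.2 ≤ p.1} with hS
  have hSm : MeasurableSet S := measurableSet_le (by fun_prop) (by fun_prop)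
  have hsub : {g | ρ * A ≤ sphereProj ρ g ⬝ᵥ y} ⊆
      {g : Fin (m + 1) → ℝ | (v ⬝ᵥ g, √(g ⬝ᵥ g - (v ⬝ᵥ g) ^ 2)) ∈ S} := by
    intro g hg
    have hg' : ρ * A ≤ sphereProj ρ g ⬝ᵥ y := hg
    have hg0 : g ⬝ᵥ g ≠ 0 := fun h0 => by
      have : ρ * A ≤ 0 := by simpa [sphereProj, h0] using hg'
      exact absurd this (not_le.2 (by positivity))
    have hG : 0 < g ⬝ᵥ g := (dotProduct_self_nonneg' g).lt_of_ne' hg0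
    set G := √(g ⬝ᵥ g) with hGdef
    have hGpos : 0 < G := by positivity
    have hG2 : g ⬝ᵥ g = G ^ 2 := (Real.sq_sqrt hG.le).symm
    set Y := √(y ⬝ᵥ y) with hYdef
    have hY : 0 < Y := by rw [hYdef, hy]; positivity
    have hY2 : Y ^ 2 = A ^ 2 + R ^ 2 := by rw [hYdef, hy]; exact Real.sq_sqrt hyy.le
    have e : sphereProj ρ g ⬝ᵥ y = ρ * (Y * (v ⬝ᵥ g)) / G := by
      rw [sphereProj, hyv]
      simp only [smul_dotProduct, dotProduct_smul, smul_eq_mul, dotProduct_comm g v]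
      ring
    rw [e, le_div_iff₀ hGpos, mul_assoc] at hg'
    have h1 : A * G ≤ Y * (v ⬝ᵥ g) := le_of_mul_le_mul_left hg' hρ
    set s := v ⬝ᵥ g
    have hs : 0 < s := by
      have : 0 < Y * s := lt_of_lt_of_le (by positivity) h1
      exact pos_of_mul_pos_right this hY.le
    have h2 : (A * G) ^ 2 ≤ (Y * s) ^ 2 := pow_le_pow_left₀ (by positivity) h1 2
    show κ * √(g ⬝ᵥ g - s ^ 2) ≤ s
    rw [hκ, div_mul_eq_mul_div, div_le_iff₀ hR, hG2]
    have h3 : √(G ^ 2 - s ^ 2) ≤ s * R / A := by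
      refine Real.sqrt_le_iff.2 ⟨by positivity, ?_⟩
      rw [div_pow, le_div_iff₀ (by positivity)]
      rw [mul_pow, mul_pow, hY2] at h2
      nlinarith
    rw [le_div_iff₀ hA] at h3
    linarith
  refine (measure_mono hsub).trans (le_trans (le_of_eq ?_) (lintegral_stdNormal_Ici_le hm hκ0))
  have h1 := lintegral_orthogonal_gaussVec hv (F := S.indicator 1)
    (measurable_one.indicator hSm)
  have h2 : MeasurableSet {g : Fin (m + 1) → ℝ | (v ⬝ᵥ g, √(g ⬝ᵥ g - (v ⬝ᵥ g) ^ 2)) ∈ S} :=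
    (by fun_prop : Measurable fun g : Fin (m + 1) → ℝ =>
      (v ⬝ᵥ g, √(g ⬝ᵥ g - (v ⬝ᵥ g) ^ 2))) hSm
  rw [← lintegral_indicator_one h2]
  refine Eq.trans ?_ (h1.trans ?_)
  · rfl
  · refine lintegral_congr fun w => ?_
    rw [← lintegral_indicator_one measurableSet_Ici]
    rfl

/-- Vectors `z` for which `ρ • u + z` makes an angle with `u` of cotangent larger than `k`. -/
def angleSet {n : ℕ} (ρ k : ℝ) : Set ((Fin n → ℝ) × (Fin n → ℝ)) :=
  {p | k * √(p.2 ⬝ᵥ p.2 - (p.1 ⬝ᵥ p.2 / ρ) ^ 2) < ρ + p.1 ⬝ᵥ p.2 / ρ}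

lemma measurableSet_angleSet {n : ℕ} (ρ k : ℝ) : MeasurableSet (angleSet (n := n) ρ k) :=
  measurableSet_lt (by fun_prop) (by fun_prop)

lemma smul_mem_angleSet {n : ℕ} {ρ : ℝ} (hρ : 0 < ρ) (k : ℝ) (u z : Fin n → ℝ) :
    (ρ • u, z) ∈ angleSet ρ k ↔ k * √(z ⬝ᵥ z - (u ⬝ᵥ z) ^ 2) < ρ + u ⬝ᵥ z := by
  have : ρ * (u ⬝ᵥ z) / ρ = u ⬝ᵥ z := by field_simp
  simp only [angleSet, Set.mem_ofPred_eq, smul_dotProduct, smul_eq_mul, this]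

lemma gaussVec_notMem_angleSet {m : ℕ} {ρ k : ℝ} (hρ : 0 < ρ) {u : Fin (m + 1) → ℝ}
    (hu : u ⬝ᵥ u = 1) :
    gaussVec (m + 1) {z | (ρ • u, z) ∉ angleSet ρ k} =
      ENNReal.ofReal (∫ w, Phi (k * √(w ⬝ᵥ w) - ρ) ∂gaussVec m) := by
  rw [ofReal_integral_eq_lintegral_ofReal (integrable_Phi_comp (by fun_prop))
    (Filter.Eventually.of_forall fun _ => Phi_nonneg _)]
  set S : Set (ℝ × ℝ) := {p | p.1 ≤ k * p.2 - ρ} with hS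
  have hSm : MeasurableSet S := measurableSet_le (by fun_prop) (by fun_prop)
  have h1 := lintegral_orthogonal_gaussVec hu (F := S.indicator 1)
    (measurable_one.indicator hSm)
  have h2 : MeasurableSet {g : Fin (m + 1) → ℝ | (u ⬝ᵥ g, √(g ⬝ᵥ g - (u ⬝ᵥ g) ^ 2)) ∈ S} :=
    (by fun_prop : Measurable fun g : Fin (m + 1) → ℝ =>
      (u ⬝ᵥ g, √(g ⬝ᵥ g - (u ⬝ᵥ g) ^ 2))) hSm
  have e : {z | (ρ • u, z) ∉ angleSet ρ k} =
      {g : Fin (m + 1) → ℝ | (u ⬝ᵥ g, √(g ⬝ᵥ g - (u ⬝ᵥ g) ^ 2)) ∈ S} := by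
    ext z
    simp only [Set.mem_ofPred_eq, smul_mem_angleSet hρ, not_lt, hS]
    constructor <;> intro h <;> linarith
  rw [e, ← lintegral_indicator_one h2]
  refine Eq.trans ?_ (h1.trans ?_)
  · rfl
  · refine lintegral_congr fun w => ?_
    rw [ofReal_Phi, ← lintegral_indicator_one measurableSet_Iic]
    rfl

lemma cone_bound_le {m k κ : ℝ} (hm : 0 < m) (hk : 0 < k) (hκ : k < κ) :
    √(1 + κ ^ 2) / κ * (1 + κ ^ 2) ^ (-m / 2) * (2 / √m) ≤
      √(1 + k ^ 2) / k * (1 + k ^ 2) ^ (-m / 2) * (2 / √m) *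
        (1 + 2 * k / (1 + k ^ 2) * (κ - k)) ^ (-(m / 2)) := by
  have hκ0 : 0 < κ := hk.trans hκ
  have hd : 0 < κ - k := sub_pos.2 hκ
  have h1 : √(1 + κ ^ 2) / κ ≤ √(1 + k ^ 2) / k := by
    rw [div_le_div_iff₀ hκ0 hk]
    refine le_of_sq_le_sq ?_ (by positivity)
    rw [mul_pow, mul_pow, Real.sq_sqrt (by positivity), Real.sq_sqrt (by positivity)]
    nlinarith
  have h2 : (1 + κ ^ 2) ^ (-m / 2) ≤
      (1 + k ^ 2) ^ (-m / 2) * (1 + 2 * k / (1 + k ^ 2) * (κ - k)) ^ (-(m / 2)) := by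
    rw [← neg_div, ← Real.mul_rpow (by positivity) (by positivity)]
    refine Real.rpow_le_rpow_of_nonpos (by positivity) ?_ (by linarith)
    have : (1 + k ^ 2) * (1 + 2 * k / (1 + k ^ 2) * (κ - k)) = 1 + k ^ 2 + 2 * k * (κ - k) := by
      field_simp
    rw [this]
    nlinarith [sq_nonneg (κ - k)]
  calc _ ≤ √(1 + k ^ 2) / k * ((1 + k ^ 2) ^ (-m / 2) *
        (1 + 2 * k / (1 + k ^ 2) * (κ - k)) ^ (-(m / 2))) * (2 / √m) := by gcongr
    _ = _ := by ring

lemma lintegral_pairwise_error_le {m : ℕ} (hm : 4 ≤ m) {ρ k : ℝ} (hρ : 0 < ρ) (hk : 0 < k)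
    {u : Fin (m + 1) → ℝ} (hu : u ⬝ᵥ u = 1) :
    ∫⁻ g, gaussVec (m + 1) {z | (ρ • u, z) ∈ angleSet ρ k ∧
        (ρ • u) ⬝ᵥ (ρ • u + z) ≤ sphereProj ρ g ⬝ᵥ (ρ • u + z)} ∂gaussVec (m + 1) ≤
      ENNReal.ofReal ((1 + k ^ 2) ^ (-(m : ℝ) / 2) *
        ((1 + k ^ 2) * √(1 + k ^ 2) / k ^ 2 / (m / 2 - 1))) := by
  have hm4 : (4 : ℝ) ≤ m := by exact_mod_cast hm
  have hms : 0 < √(m : ℝ) := by positivity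
  set T : Set ((Fin (m + 1) → ℝ) × (Fin (m + 1) → ℝ)) := {p | (ρ • u, p.2) ∈ angleSet ρ k ∧
        (ρ • u) ⬝ᵥ (ρ • u + p.2) ≤ sphereProj ρ p.1 ⬝ᵥ (ρ • u + p.2)} with hT
  have hTm : MeasurableSet T := by
    have h1 : MeasurableSet {p : (Fin (m + 1) → ℝ) × (Fin (m + 1) → ℝ) |
        (ρ • u) ⬝ᵥ (ρ • u + p.2) ≤ sphereProj ρ p.1 ⬝ᵥ (ρ • u + p.2)} :=
      measurableSet_le (by fun_prop) (by fun_prop)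
    exact ((by fun_prop : Measurable fun p : (Fin (m + 1) → ℝ) × (Fin (m + 1) → ℝ) =>
        (ρ • u, p.2)) (measurableSet_angleSet ρ k)).inter h1
  set B : ℝ := √(1 + k ^ 2) / k * (1 + k ^ 2) ^ (-(m : ℝ) / 2) * (2 / √m) with hB
  have hB0 : 0 ≤ B := by positivity
  set b : ℝ := 2 * k / (1 + k ^ 2) with hb
  have hb0 : 0 < b := by positivity
  let F : ℝ × ℝ → ℝ≥0∞ := fun p => if 0 < p.2 then
    {p : ℝ × ℝ | k * p.2 - ρ < p.1}.indicator (fun p => ENNReal.ofReal (B *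
      (1 + b * ((ρ + p.1) / p.2 - k)) ^ (-((m : ℝ) / 2)))) p else 1
  have hFm : Measurable F := by
    refine Measurable.ite (measurableSet_lt (by fun_prop) (by fun_prop)) ?_ (by fun_prop)
    exact Measurable.indicator (by fun_prop) (measurableSet_lt (by fun_prop) (by fun_prop))
  have hae : ∀ᵐ w ∂gaussVec m, w ⬝ᵥ w ≠ 0 := by
    rw [ae_iff]; simpa using gaussVec_dotProduct_self_eq_zero (by omega : 0 < m)
  calc _ = ((gaussVec (m + 1)).prod (gaussVec (m + 1))) T := (Measure.prod_apply hTm).symm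
    _ = ∫⁻ z, gaussVec (m + 1) {g | (ρ • u, z) ∈ angleSet ρ k ∧
        (ρ • u) ⬝ᵥ (ρ • u + z) ≤ sphereProj ρ g ⬝ᵥ (ρ • u + z)} ∂gaussVec (m + 1) :=
        Measure.prod_apply_symm hTm
    _ ≤ ∫⁻ z, F (u ⬝ᵥ z, √(z ⬝ᵥ z - (u ⬝ᵥ z) ^ 2)) ∂gaussVec (m + 1) := by
        refine lintegral_mono fun z => ?_
        simp only [F]
        split_ifs with hR
        · by_cases hz : (ρ • u, z) ∈ angleSet ρ k
          · have hz' := (smul_mem_angleSet hρ k u z).1 hz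
            set R := √(z ⬝ᵥ z - (u ⬝ᵥ z) ^ 2) with hRdef
            have hR2 : R ^ 2 = z ⬝ᵥ z - (u ⬝ᵥ z) ^ 2 := Real.sq_sqrt (Real.sqrt_pos.1 hR).le
            have hA : 0 < ρ + u ⬝ᵥ z := lt_of_le_of_lt (by positivity) hz'
            have hy : (ρ • u + z) ⬝ᵥ (ρ • u + z) = (ρ + u ⬝ᵥ z) ^ 2 + R ^ 2 := by
              rw [hR2]
              simp only [add_dotProduct, dotProduct_add, smul_dotProduct, dotProduct_smul,
                smul_eq_mul, hu, dotProduct_comm z u]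
              ring
            have hx : (ρ • u) ⬝ᵥ (ρ • u + z) = ρ * (ρ + u ⬝ᵥ z) := by
              simp only [dotProduct_add, smul_dotProduct, dotProduct_smul, smul_eq_mul, hu]
              ring
            rw [Set.indicator_of_mem (by show k * R - ρ < u ⬝ᵥ z; linarith)]
            refine le_trans (measure_mono fun g hg => ?_)
              ((gaussVec_sphereProj_dotProduct_ge_le hm hρ hA hR hy).trans
                (ENNReal.ofReal_le_ofReal (cone_bound_le (by linarith) hk ?_)))
            · have := hg.2
              rwa [hx] at this
            · rwa [lt_div_iff₀ hR]
          · simp [hz]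
        · exact prob_le_one
    _ = ∫⁻ w, ∫⁻ t, F (t, √(w ⬝ᵥ w)) ∂stdNormal ∂gaussVec m := lintegral_orthogonal_gaussVec hu hFm
    _ ≤ ∫⁻ w, ENNReal.ofReal (B / (b * (m / 2 - 1))) * ENNReal.ofReal (√(w ⬝ᵥ w)) ∂gaussVec m := by
        refine lintegral_mono_ae (hae.mono fun w hw => ?_)
        have hw0 : 0 < √(w ⬝ᵥ w) := Real.sqrt_pos.2 ((dotProduct_self_nonneg' w).lt_of_ne' hw)
        set r := √(w ⬝ᵥ w)
        have hm2 : 0 < (m : ℝ) / 2 - 1 := by linarith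
        have e : ∀ t, F (t, r) = (Set.Ioi (k * r - ρ)).indicator (fun t => ENNReal.ofReal B *
            ENNReal.ofReal ((1 + b / r * (t - (k * r - ρ))) ^ (-((m : ℝ) / 2)))) t := by
          intro t
          simp only [F, hw0, if_true, Set.indicator, Set.mem_ofPred_eq, Set.mem_Ioi]
          split_ifs
          · rw [← ENNReal.ofReal_mul hB0]
            congr 4
            field_simp
            ring
          · rfl
        rw [lintegral_congr e, lintegral_indicator measurableSet_Ioi,
          lintegral_const_mul' _ _ ENNReal.ofReal_ne_top, ← ENNReal.ofReal_mul (by positivity)]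
        refine (mul_le_mul_right (lintegral_Ioi_rpow_stdNormal_le (by linarith) (by positivity) _)
          _).trans ?_
        rw [← ENNReal.ofReal_mul hB0]
        refine ENNReal.ofReal_le_ofReal (le_of_eq ?_)
        field_simp
    _ ≤ ENNReal.ofReal (B / (b * (m / 2 - 1))) * ENNReal.ofReal √m := by
        rw [lintegral_const_mul' _ _ ENNReal.ofReal_ne_top]
        gcongr
        exact lintegral_norm_gaussVec_le (by omega)
    _ = _ := by
        have hm2 : 0 < (m : ℝ) / 2 - 1 := by linarith
        rw [← ENNReal.ofReal_mul (by positivity)]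
        congr 1
        rw [hB, hb]
        field_simp

lemma isCode_of_integral_Phi_le {m M : ℕ} (hm : 4 ≤ m) {k P ε : ℝ} (hk : 0 < k) (hP : 0 < P)
    (hM : 0 < M) (hMle : (M : ℝ) ≤ √m * (1 + k ^ 2) ^ ((m : ℝ) / 2))
    (hε : ∫ w, Phi (k * √(w ⬝ᵥ w) - √((m + 1) * P)) ∂gaussVec m +
      4 * ((1 + k ^ 2) * √(1 + k ^ 2)) / k ^ 2 / √m ≤ ε) : IsCode (m + 1) M ε P := by
  have hm4 : (4 : ℝ) ≤ m := by exact_mod_cast hm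
  have hms : 0 < √(m : ℝ) := by positivity
  set ρ := √((m + 1) * P) with hρdef
  have hρ : 0 < ρ := by positivity
  have hρ2 : ρ ^ 2 = (m + 1) * P := Real.sq_sqrt (by positivity)
  have hint : 0 ≤ ∫ w, Phi (k * √(w ⬝ᵥ w) - ρ) ∂gaussVec m :=
    integral_nonneg fun _ => Phi_nonneg _
  have hae : ∀ᵐ w ∂gaussVec (m + 1), w ⬝ᵥ w ≠ 0 := by
    rw [ae_iff]; simpa using gaussVec_dotProduct_self_eq_zero (by omega : 0 < m + 1)
  refine isCode_of_random_coding hM (le_trans (by positivity) hε) (measurable_sphereProj ρ)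
    (fun g => ?_) (measurableSet_angleSet ρ k)
    (β := ENNReal.ofReal (∫ w, Phi (k * √(w ⬝ᵥ w) - ρ) ∂gaussVec m))
    (η := ENNReal.ofReal ((1 + k ^ 2) ^ (-(m : ℝ) / 2) *
        ((1 + k ^ 2) * √(1 + k ^ 2) / k ^ 2 / (m / 2 - 1)))) ?_ ?_ ?_
  · have := sphereProj_dotProduct_self_le ρ g
    rw [hρ2] at this
    simpa [dotProduct, sq] using this
  · calc _ ≤ ∫⁻ _, ENNReal.ofReal (∫ w, Phi (k * √(w ⬝ᵥ w) - ρ) ∂gaussVec m)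
          ∂gaussVec (m + 1) := by
          refine lintegral_mono_ae (hae.mono fun g hg => ?_)
          obtain ⟨u, hu, -, hgu⟩ := exists_unit_sphereProj ρ hg
          rw [hgu]
          exact (gaussVec_notMem_angleSet hρ hu).le
      _ = _ := by simp
  · refine (lintegral_prod_le _).trans ?_
    calc _ ≤ ∫⁻ _, ENNReal.ofReal ((1 + k ^ 2) ^ (-(m : ℝ) / 2) *
            ((1 + k ^ 2) * √(1 + k ^ 2) / k ^ 2 / (m / 2 - 1))) ∂gaussVec (m + 1) := by
          refine lintegral_mono_ae (hae.mono fun g hg => ?_)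
          obtain ⟨u, hu, -, hgu⟩ := exists_unit_sphereProj ρ hg
          dsimp only
          rw [hgu]
          exact lintegral_pairwise_error_le hm hρ hk hu
      _ = _ := by simp
  · have hm2 : 0 < (m : ℝ) / 2 - 1 := by linarith
    rw [← ENNReal.ofReal_natCast, ← ENNReal.ofReal_mul (by positivity),
      ← ENNReal.ofReal_add hint (by positivity)]
    refine ENNReal.ofReal_le_ofReal (le_trans ?_ hε)
    gcongr
    set s := (1 + k ^ 2) * √(1 + k ^ 2) with hs
    have hs0 : 0 < s := by positivity
    calc _ ≤ √m * (1 + k ^ 2) ^ ((m : ℝ) / 2) *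
          ((1 + k ^ 2) ^ (-(m : ℝ) / 2) * (s / k ^ 2 / (m / 2 - 1))) := by gcongr
      _ = √m * (s / k ^ 2 / (m / 2 - 1)) := by
          rw [show √(m : ℝ) * (1 + k ^ 2) ^ ((m : ℝ) / 2) *
            ((1 + k ^ 2) ^ (-(m : ℝ) / 2) * (s / k ^ 2 / (m / 2 - 1))) = √m *
            ((1 + k ^ 2) ^ ((m : ℝ) / 2) * (1 + k ^ 2) ^ (-(m : ℝ) / 2)) *
              (s / k ^ 2 / (m / 2 - 1)) by ring, ← Real.rpow_add (by positivity)]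
          simp [neg_div]
      _ ≤ _ := by
          obtain ⟨p, hp, hp2⟩ : ∃ p : ℝ, √(m : ℝ) = p ∧ (m : ℝ) = p ^ 2 :=
            ⟨_, rfl, (Real.sq_sqrt (by linarith)).symm⟩
          rw [hp] at hms
          rw [hp, hp2]
          rw [hp2] at hm4 hm2
          rw [div_div, div_div, mul_div_assoc', div_le_div_iff₀ (by positivity) (by positivity)]
          have : 0 ≤ s * k ^ 2 * (p ^ 2 - 4) := by
            have : 0 ≤ p ^ 2 - 4 := by linarith
            positivity
          linarith

lemma pi_measure_mono {ι : Type*} [Fintype ι] {α : ι → Type*} [∀ i, MeasurableSpace (α i)]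
    {μ ν : ∀ i, Measure (α i)} (h : ∀ i, μ i ≤ ν i) : Measure.pi μ ≤ Measure.pi ν := by
  refine Measure.le_iff.2 fun s hs => ?_
  rw [Measure.pi, Measure.pi, toMeasure_apply _ _ hs, toMeasure_apply _ _ hs]
  refine OuterMeasure.le_pi.2 (fun t _ => ?_) s
  exact (OuterMeasure.pi_pi_le _ _).trans (Finset.prod_le_prod' fun i _ => h i (t i))

lemma gaussianReal_le_smul {a R : ℝ} (ha : a ^ 2 ≤ R) :
    gaussianReal a 1 ≤ ENNReal.ofReal (√2 * Real.exp (R / 2)) • gaussianReal 0 2 := by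
  rw [gaussianReal_of_var_ne_zero a one_ne_zero, gaussianReal_of_var_ne_zero 0 two_ne_zero,
    ← withDensity_smul _ (measurable_gaussianPDF 0 2)]
  refine withDensity_mono (Filter.Eventually.of_forall fun y => ?_)
  simp only [Pi.smul_apply, smul_eq_mul, gaussianPDF]
  rw [← ENNReal.ofReal_mul (by positivity)]
  refine ENNReal.ofReal_le_ofReal ?_
  simp only [gaussianPDFReal, NNReal.coe_one, NNReal.coe_ofNat, mul_one, sub_zero]
  have e : √(2 * π * 2) = √2 * √(2 * π) := by
    rw [mul_comm, Real.sqrt_mul (by norm_num)]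
  rw [e]
  calc _ ≤ (√(2 * π))⁻¹ * (Real.exp (R / 2) * Real.exp (-y ^ 2 / (2 * 2))) := by
        rw [← Real.exp_add]
        gcongr
        nlinarith [sq_nonneg (y - 2 * a)]
    _ = _ := by
        field_simp

lemma Wn_le_pi {n : ℕ} {x : Fin n → ℝ} {R : ℝ} (hx : ∀ i, x i ^ 2 ≤ R) {D : Set (Fin n → ℝ)}
    (hD : MeasurableSet D) :
    Wn n x D ≤ (Measure.pi fun _ : Fin n =>
      ENNReal.ofReal (√2 * Real.exp (R / 2)) • gaussianReal 0 2) D := by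
  have hmap : (gaussVec n).map (fun z i => x i + z i) =
      Measure.pi fun i => gaussianReal (x i) 1 := by
    have := Measure.pi_map_pi (μ := fun _ : Fin n => stdNormal) (f := fun i z => x i + z)
      (hμ := fun i => by
        have := Measure.isProbabilityMeasure_map (μ := stdNormal)
          (f := fun z => x i + z) (by fun_prop)
        infer_instance)
      (fun i => by fun_prop)
    rw [this]
    congr 1
    funext i
    rw [gaussianReal_map_const_add, zero_add]
  calc Wn n x D = (gaussVec n).map (fun z i => x i + z i) D :=
        (Measure.map_apply (by fun_prop) hD).symm
    _ ≤ _ := by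
        rw [hmap]
        exact pi_measure_mono (fun i => gaussianReal_le_smul (hx i)) D

lemma bddAbove_setOf_isCode (n : ℕ) {ε P : ℝ} (hε : ε < 1) :
    BddAbove {M : ℕ | IsCode n M ε P} := by
  set ν : Measure (Fin n → ℝ) := Measure.pi fun _ : Fin n =>
      ENNReal.ofReal (√2 * Real.exp (n * P / 2)) • gaussianReal 0 2 with hν
  have hfin : IsFiniteMeasure ν := by
    have : IsFiniteMeasure (ENNReal.ofReal (√2 * Real.exp (n * P / 2)) • gaussianReal 0 2) :=
      Measure.smul_finite _ ENNReal.ofReal_ne_top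
    infer_instance
  refine ⟨⌈ν.real Set.univ / (1 - ε)⌉₊, fun M hM => ?_⟩
  obtain ⟨x, D, hP, hD, hdisj, herr⟩ := hM
  rcases Nat.eq_zero_or_pos M with rfl | hM0
  · exact Nat.zero_le _
  have hM' : (0 : ℝ) < M := by exact_mod_cast hM0
  have hprob : ∀ m, (Wn n (x m) (D m)).toReal + (Wn n (x m) (D m)ᶜ).toReal = 1 := fun m => by
    have hm : MeasurableSet {z : Fin n → ℝ | (fun i => x m i + z i) ∈ D m} :=
      (by fun_prop : Measurable fun (z : Fin n → ℝ) i => x m i + z i) (hD m)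
    have := measureReal_add_measureReal_compl (μ := gaussVec n) hm
    rw [probReal_univ] at this
    exact this
  have hsum : ∑ m, (Wn n (x m) (D m)).toReal ≤ ν.real Set.univ := by
    calc _ ≤ ∑ m, ν.real (D m) := by
          refine Finset.sum_le_sum fun m _ => ENNReal.toReal_mono (measure_ne_top _ _) ?_
          refine Wn_le_pi (fun i => ?_) (hD m)
          exact (Finset.single_le_sum (f := fun i => x m i ^ 2) (fun i _ => sq_nonneg _)
            (Finset.mem_univ i)).trans (hP m)
      _ = ν.real (⋃ m, D m) := by
          rw [measureReal_iUnion_fintype (fun m m' h => hdisj m m' h) hD]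
      _ ≤ _ := measureReal_mono (Set.subset_univ _)
  have htot : ∑ m, (Wn n (x m) (D m)).toReal + ∑ m, (Wn n (x m) (D m)ᶜ).toReal = M := by
    rw [← Finset.sum_add_distrib, Finset.sum_congr rfl fun m _ => hprob m]
    simp
  rw [one_div, inv_mul_le_iff₀ hM'] at herr
  have : (M : ℝ) ≤ ν.real Set.univ / (1 - ε) := by
    rw [le_div_iff₀ (by linarith)]
    linarith
  exact_mod_cast this.trans (Nat.le_ceil _)

/-- A parabolic perturbation of the signal amplitude `√P`, as a function of `t = 1 / √n`. -/
def amplitude (P a d t : ℝ) : ℝ := √P + a * t - d * t ^ 2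

lemma hasDerivAt_amplitude (P a d : ℝ) : HasDerivAt (amplitude P a d) a 0 := by
  have := (((hasDerivAt_id' (0 : ℝ)).const_mul a).const_add √P).fun_sub
    (((hasDerivAt_id' (0 : ℝ)).fun_pow 2).const_mul d)
  exact this.congr_deriv (by simp)

lemma amplitude_zero (P a d : ℝ) : amplitude P a d 0 = √P := by simp [amplitude]

lemma eventually_lt_of_hasDerivAt_neg {f : ℝ → ℝ} {f' : ℝ} (hf : HasDerivAt f f' 0)
    (h : f' < 0) : ∀ᶠ t in nhdsWithin 0 (Set.Ioi 0), f t < f 0 := by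
  have h1 := (hasDerivAt_iff_tendsto_slope.1 hf).eventually_lt_const h
  have h2 : ∀ᶠ t in nhdsWithin 0 (Set.Ioi 0), slope f 0 t < 0 :=
    h1.filter_mono (nhdsWithin_mono _ fun t ht => ne_of_gt ht)
  filter_upwards [h2, self_mem_nhdsWithin] with t ht ht0
  rw [slope_def_field, sub_zero, div_neg_iff] at ht
  rcases ht with ht | ht
  · exact absurd ht.2 (not_lt.2 (le_of_lt ht0))
  · linarith [ht.1]

/-- The total error probability bound for blocklength `n`, in terms of `t = 1 / √n`, drops below `ε`
for small `t` once the second order correction `d` is large enough. -/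
lemma exists_eventually_error_lt {ε P : ℝ} (hε : ε ∈ Set.Ioo (0 : ℝ) 1) (hP : 0 < P) (K : ℝ) :
    ∃ d : ℝ, ∀ᶠ t in nhdsWithin 0 (Set.Ioi 0),
      Phi ((√(1 + P / 2) * PhiInv ε - d * t) /
        √(1 + amplitude P (√(1 + P / 2) * PhiInv ε) d t ^ 2 * (1 - t ^ 2) / 2)) +
      t * (K * amplitude P (√(1 + P / 2) * PhiInv ε) d t ^ 3 * (1 - t ^ 2) / 8 +
        4 * ((1 + amplitude P (√(1 + P / 2) * PhiInv ε) d t ^ 2) *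
          √(1 + amplitude P (√(1 + P / 2) * PhiInv ε) d t ^ 2)) /
          amplitude P (√(1 + P / 2) * PhiInv ε) d t ^ 2 / √(1 - t ^ 2)) < ε := by
  set q := PhiInv ε with hq
  set σ := √(1 + P / 2) with hσ
  have hσ0 : 0 < σ := by positivity
  have hσ2 : σ ^ 2 = 1 + P / 2 := Real.sq_sqrt (by positivity)
  have hP2 : √P ^ 2 = P := Real.sq_sqrt hP.le
  have hsP : 0 < √P := by positivity
  set a := σ * q with ha
  set E₀ : ℝ := K * √P ^ 3 / 8 + 4 * ((1 + P) * √(1 + P)) / P with hE₀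
  have hφ := normalDensity_pos q
  set d : ℝ := σ * (E₀ + 1) / normalDensity q with hd
  refine ⟨d, ?_⟩
  set k := amplitude P a d with hk
  have hk' : HasDerivAt k a 0 := hasDerivAt_amplitude P a d
  have hk0 : k 0 = √P := amplitude_zero P a d
  let E : ℝ → ℝ := fun t => K * k t ^ 3 * (1 - t ^ 2) / 8 +
    4 * ((1 + k t ^ 2) * √(1 + k t ^ 2)) / k t ^ 2 / √(1 - t ^ 2)
  have hEd : DifferentiableAt ℝ E 0 := by
    have hkd : DifferentiableAt ℝ k 0 := hk'.differentiableAt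
    have h1 : DifferentiableAt ℝ (fun t => √(1 + k t ^ 2)) 0 :=
      DifferentiableAt.sqrt (by fun_prop) (by positivity)
    have h2 : DifferentiableAt ℝ (fun t : ℝ => √(1 - t ^ 2)) 0 :=
      DifferentiableAt.sqrt (by fun_prop) (by norm_num)
    have h3 : k 0 ^ 2 ≠ 0 := by rw [hk0]; positivity
    have h4 : √(1 - (0 : ℝ) ^ 2) ≠ 0 := by norm_num
    exact DifferentiableAt.add (by fun_prop) (DifferentiableAt.fun_div
      (DifferentiableAt.fun_div (by fun_prop) (by fun_prop) h3) h2 h4)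
  have hE0 : E 0 = E₀ := by simp [E, hk0, hP2, hE₀]
  have hden : HasDerivAt (fun t => 1 + k t ^ 2 * (1 - t ^ 2) / 2) (√P * a) 0 := by
    have h1 := (((hk'.fun_pow 2).fun_mul (((hasDerivAt_id' (0 : ℝ)).fun_pow 2).const_sub 1)).div_const
      2).const_add 1
    refine h1.congr_deriv ?_
    simp [hk0]
    ring
  have hden0 : 1 + k 0 ^ 2 * (1 - 0 ^ 2) / 2 = σ ^ 2 := by rw [hk0, hP2, hσ2]; ring
  have hsq : HasDerivAt (fun t => √(1 + k t ^ 2 * (1 - t ^ 2) / 2)) (√P * a / (2 * σ)) 0 := by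
    have := hden.sqrt (by rw [hden0]; positivity)
    rwa [hden0, Real.sqrt_sq hσ0.le] at this
  have hsq0 : √(1 + k 0 ^ 2 * (1 - 0 ^ 2) / 2) = σ := by rw [hden0, Real.sqrt_sq hσ0.le]
  have hnum : HasDerivAt (fun t => a - d * t) (-d) 0 := by
    simpa using ((hasDerivAt_id' (0 : ℝ)).const_mul d).const_sub a
  have hs : HasDerivAt (fun t => (a - d * t) / √(1 + k t ^ 2 * (1 - t ^ 2) / 2))
      ((-d * σ - a * (√P * a / (2 * σ))) / σ ^ 2) 0 := by
    have := hnum.fun_div hsq (by rw [hsq0]; exact hσ0.ne')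
    rw [hsq0] at this
    simpa using this
  have hs0 : (a - d * 0) / √(1 + k 0 ^ 2 * (1 - 0 ^ 2) / 2) = q := by
    rw [hsq0, ha]; field_simp; ring
  have hPhi : HasDerivAt (fun t => Phi ((a - d * t) / √(1 + k t ^ 2 * (1 - t ^ 2) / 2)))
      (normalDensity q * ((-d * σ - a * (√P * a / (2 * σ))) / σ ^ 2)) 0 := by
    refine HasDerivAt.comp (h₂ := Phi) (0 : ℝ) ?_ hs
    rw [hs0]
    exact hasDerivAt_Phi q
  have htE : HasDerivAt (fun t => t * E t) E₀ 0 := by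
    have := (hasDerivAt_id' (0 : ℝ)).fun_mul hEd.hasDerivAt
    simpa [hE0] using this
  have hneg : normalDensity q * ((-d * σ - a * (√P * a / (2 * σ))) / σ ^ 2) + E₀ < 0 := by
    have e : normalDensity q * ((-d * σ - a * (√P * a / (2 * σ))) / σ ^ 2) + E₀ =
        -1 - normalDensity q * √P * a ^ 2 / (2 * σ ^ 3) := by
      rw [hd]; field_simp; ring
    have : 0 ≤ normalDensity q * √P * a ^ 2 / (2 * σ ^ 3) := by positivity
    rw [e]; linarith
  have := eventually_lt_of_hasDerivAt_neg (hPhi.fun_add htE) hneg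
  rw [hs0, hq, Phi_PhiInv hε, zero_mul, add_zero] at this
  exact this

lemma exists_log_one_add_amplitude_sq_ge {P : ℝ} (hP : 0 < P) (a d : ℝ) :
    ∃ c : ℝ, ∀ t ∈ Set.Icc (0 : ℝ) 1, Real.log (1 + P) + 2 * √P * a / (1 + P) * t - c * t ^ 2 ≤
      Real.log (1 + amplitude P a d t ^ 2) := by
  have hP2 : √P ^ 2 = P := Real.sq_sqrt hP.le
  have hsP : 0 < √P := by positivity
  set A := |a| + |d| with hA
  have hA0 : 0 ≤ A := by positivity
  refine ⟨2 * √P * |d| / (1 + P) + (2 * √P * A + A ^ 2) ^ 2 / (1 + P), fun t ht => ?_⟩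
  have hpos : 0 < 1 + amplitude P a d t ^ 2 := by positivity
  set D := a - d * t with hD
  have hDA : |D| ≤ A := by
    calc |D| ≤ |a| + |d * t| := abs_sub _ _
      _ ≤ A := by
        rw [abs_mul, abs_of_nonneg ht.1, hA]
        gcongr
        exact mul_le_of_le_one_right (abs_nonneg d) ht.2
  set y := (2 * √P * (D * t) + (D * t) ^ 2) / (1 + P) with hy
  have hky : 1 + amplitude P a d t ^ 2 = (1 + P) * (1 + y) := by
    rw [hy, mul_add, mul_div_cancel₀ _ (by positivity), amplitude, hD]
    nlinarith
  have hy1 : 0 < 1 + y := by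
    rw [hky] at hpos
    exact pos_of_mul_pos_right hpos (by positivity)
  have hy2 : 1 / (1 + P) ≤ 1 + y := by
    rw [div_le_iff₀ (by positivity), mul_comm, ← hky]
    nlinarith [sq_nonneg (amplitude P a d t)]
  have hlog : y - (1 + P) * y ^ 2 ≤ Real.log (1 + y) := by
    refine le_trans ?_ (Real.one_sub_inv_le_log_of_pos hy1)
    have : (1 + y)⁻¹ ≤ 1 + P := by
      rw [inv_le_comm₀ hy1 (by positivity), ← one_div]; exact hy2
    have e : 1 - (1 + y)⁻¹ = y - y ^ 2 * (1 + y)⁻¹ := by field_simp; ring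
    rw [e]
    nlinarith [mul_le_mul_of_nonneg_left this (sq_nonneg y)]
  have hyabs : (1 + P) * y ^ 2 ≤ (2 * √P * A + A ^ 2) ^ 2 / (1 + P) * t ^ 2 := by
    have h1 : |2 * √P * D + D ^ 2 * t| ≤ 2 * √P * A + A ^ 2 := by
      calc _ ≤ |2 * √P * D| + |D ^ 2 * t| := abs_add_le _ _
        _ ≤ _ := by
          rw [abs_mul, abs_of_pos (by positivity : 0 < 2 * √P), abs_mul, abs_of_nonneg ht.1, abs_pow]
          gcongr
          calc |D| ^ 2 * t ≤ |D| ^ 2 := mul_le_of_le_one_right (by positivity) ht.2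
            _ ≤ A ^ 2 := by gcongr
    have e : (1 + P) * y ^ 2 = (2 * √P * D + D ^ 2 * t) ^ 2 / (1 + P) * t ^ 2 := by
      rw [hy]; field_simp
    rw [e]
    gcongr ?_ / _ * _
    exact sq_le_sq' (abs_le.1 h1).1 (abs_le.1 h1).2
  have hylb : 2 * √P * a / (1 + P) * t - 2 * √P * |d| / (1 + P) * t ^ 2 ≤ y := by
    have : y - (2 * √P * a / (1 + P) * t - 2 * √P * |d| / (1 + P) * t ^ 2) =
        (2 * √P * (|d| - d) * t ^ 2 + (D * t) ^ 2) / (1 + P) := by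
      rw [hy, hD]; field_simp; ring
    have h0 : 0 ≤ |d| - d := sub_nonneg.2 (le_abs_self d)
    have : 0 ≤ (2 * √P * (|d| - d) * t ^ 2 + (D * t) ^ 2) / (1 + P) := by positivity
    linarith
  rw [hky, Real.log_mul (by positivity) hy1.ne']
  linarith

lemma log_natFloor_ge {x : ℝ} (hx : 1 ≤ x) : Real.log x - Real.log 2 ≤ Real.log ⌊x⌋₊ := by
  have h1 : (1 : ℝ) ≤ ⌊x⌋₊ := by exact_mod_cast (Nat.one_le_floor_iff x).2 hx
  have h2 := Nat.lt_floor_add_one x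
  rw [← Real.log_div (by positivity) (by norm_num)]
  exact Real.log_le_log (by positivity) (by linarith)

lemma integral_Phi_amplitude_le {K : ℝ} (hK : ∀ (m : ℕ) (h x : ℝ), 0 ≤ h →
      ∫ w, Phi (x + h * (w ⬝ᵥ w - m)) ∂gaussVec m ≤
        Phi (x / √(1 + 2 * m * h ^ 2)) + m * (K * h ^ 3))
    {P a d : ℝ} (m : ℕ) {t : ℝ} (ht : t = 1 / √((m : ℝ) + 1))
    (hk : 0 < amplitude P a d t) :
    ∫ w, Phi (amplitude P a d t * √(w ⬝ᵥ w) - √((m + 1) * P)) ∂gaussVec m ≤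
      Phi ((a - d * t) / √(1 + amplitude P a d t ^ 2 * (1 - t ^ 2) / 2)) +
        t * (K * amplitude P a d t ^ 3 * (1 - t ^ 2) / 8) := by
  obtain ⟨s, hs, hs2⟩ : ∃ s : ℝ, √((m : ℝ) + 1) = s ∧ s ^ 2 = m + 1 :=
    ⟨_, rfl, Real.sq_sqrt (by positivity)⟩
  have hs0 : 0 < s := by rw [← hs]; positivity
  rw [hs] at ht
  have hm : (m : ℝ) = s ^ 2 - 1 := by linarith
  set k := amplitude P a d t with hkdef
  have hks : k * s - s * √P = a - d * t := by
    rw [hkdef, amplitude, ht]; field_simp; ring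
  have ht0 : 0 < t := by rw [ht]; positivity
  calc _ ≤ ∫ w, Phi ((a - d * t) + k * t / 2 * (w ⬝ᵥ w - m)) ∂gaussVec m := by
        refine integral_mono (integrable_Phi_comp (by fun_prop))
          (integrable_Phi_comp (by fun_prop)) fun w => Phi_mono ?_
        rw [Real.sqrt_mul (by positivity), hs, ← hks]
        have hw := Real.sq_sqrt (dotProduct_self_nonneg' w)
        set r := √(w ⬝ᵥ w)
        rw [← hw, hm, ht]
        have : k * s - s * √P + k * (1 / s) / 2 * (r ^ 2 - (s ^ 2 - 1)) - (k * r - s * √P) =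
            k * ((r - s) ^ 2 + 1) / (2 * s) := by
          field_simp; ring
        have : 0 ≤ k * ((r - s) ^ 2 + 1) / (2 * s) := by positivity
        linarith
    _ ≤ _ := hK m _ _ (by positivity)
    _ = _ := by
        rw [hm, ht]
        have e₁ : 1 + 2 * (s ^ 2 - 1) * (k * (1 / s) / 2) ^ 2 =
            1 + k ^ 2 * (1 - (1 / s) ^ 2) / 2 := by field_simp
        have e₂ : (s ^ 2 - 1) * (K * (k * (1 / s) / 2) ^ 3) =
            1 / s * (K * k ^ 3 * (1 - (1 / s) ^ 2) / 8) := by field_simp; ring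
        rw [e₁, e₂]

/-- Third-order achievability for the AWGN channel: the third-order term in the normal
approximation is at least `(1/2) log n + O(1)`. -/
theorem awgn_third_order_achievability (ε P : ℝ) (hε : ε ∈ Set.Ioo (0 : ℝ) 1) (hP : 0 < P) :
    ∃ c > (0 : ℝ), ∃ N : ℕ, ∀ n : ℕ, n ≥ N →
      Real.log (Mstar n ε P) ≥
        n * gaussC P + Real.sqrt (n * gaussV P) * PhiInv ε + (1 / 2) * Real.log n - c := by
  obtain ⟨K, -, hK⟩ := exists_integral_Phi_gaussVec_le
  obtain ⟨d, hd⟩ := exists_eventually_error_lt hε hP K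
  set a := √(1 + P / 2) * PhiInv ε with ha
  obtain ⟨c₁, hc₁⟩ := exists_log_one_add_amplitude_sq_ge hP a d
  set A := √P + |a| + |d| with hA
  have hA0 : 0 ≤ A := by positivity
  have hk0 : ∀ᶠ t in nhdsWithin 0 (Set.Ioi 0), 0 < amplitude P a d t := by
    have h := (hasDerivAt_amplitude P a d).continuousAt.tendsto
    rw [amplitude_zero] at h
    exact (h.eventually_const_lt (Real.sqrt_pos.2 hP)).filter_mono nhdsWithin_le_nhds
  have htend : Filter.Tendsto (fun n : ℕ => 1 / √(n : ℝ)) Filter.atTop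
      (nhdsWithin 0 (Set.Ioi 0)) := by
    refine tendsto_nhdsWithin_iff.2 ⟨?_, ?_⟩
    · simp only [one_div]
      exact (Real.tendsto_sqrt_atTop.comp tendsto_natCast_atTop_atTop).inv_tendsto_atTop
    · filter_upwards [Filter.eventually_gt_atTop 0] with n hn
      have : (0 : ℝ) < n := by exact_mod_cast hn
      exact Set.mem_Ioi.2 (by positivity)
  obtain ⟨N, hN⟩ := Filter.eventually_atTop.1 (htend.eventually (hd.and hk0))
  refine ⟨|c₁| / 2 + Real.log (1 + A ^ 2) / 2 + 2 * Real.log 2, ?_, max N 5, fun n hn => ?_⟩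
  · have h1 : 0 ≤ Real.log (1 + A ^ 2) := Real.log_nonneg (by nlinarith)
    have h2 : 0 < Real.log 2 := Real.log_pos (by norm_num)
    positivity
  obtain ⟨herr, hk⟩ := hN n ((le_max_left _ _).trans hn)
  obtain ⟨m, rfl⟩ : ∃ m, n = m + 1 := ⟨n - 1, by have := (le_max_right N 5).trans hn; omega⟩
  have hm : 4 ≤ m := by have := (le_max_right N 5).trans hn; omega
  have hm4 : (4 : ℝ) ≤ m := by exact_mod_cast hm
  push_cast at herr hk ⊢
  obtain ⟨s, hs, hs2⟩ : ∃ s : ℝ, √((m : ℝ) + 1) = s ∧ s ^ 2 = m + 1 :=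
    ⟨_, rfl, Real.sq_sqrt (by positivity)⟩
  have hs1 : 1 ≤ s := by rw [← hs, Real.one_le_sqrt]; linarith
  have hs0 : 0 < s := by linarith
  have hbound := integral_Phi_amplitude_le hK (P := P) (a := a) (d := d) m rfl hk
  rw [hs] at herr hk hbound
  set t := 1 / s with ht
  have ht0 : 0 < t := by positivity
  have ht1 : t ≤ 1 := by rw [ht, div_le_one hs0]; exact hs1
  set k := amplitude P a d t with hkdef
  set X := √(m : ℝ) * (1 + k ^ 2) ^ ((m : ℝ) / 2) with hX
  have hX1 : 1 ≤ X := by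
    refine one_le_mul_of_one_le_of_one_le (Real.one_le_sqrt.2 (by linarith)) ?_
    exact Real.one_le_rpow (by nlinarith) (by positivity)
  have hM0 : 0 < ⌊X⌋₊ := Nat.floor_pos.2 hX1
  have hcode : IsCode (m + 1) ⌊X⌋₊ ε P := by
    refine isCode_of_integral_Phi_le hm hk hP hM0 (Nat.floor_le (by linarith)) ?_
    have hsm : √(m : ℝ) = s * √(1 - t ^ 2) := by
      have : (m : ℝ) = s ^ 2 * (1 - t ^ 2) := by rw [ht]; field_simp; linarith
      rw [this, Real.sqrt_mul (by positivity), Real.sqrt_sq hs0.le]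
    have e : 4 * ((1 + k ^ 2) * √(1 + k ^ 2)) / k ^ 2 / √m =
        t * (4 * ((1 + k ^ 2) * √(1 + k ^ 2)) / k ^ 2 / √(1 - t ^ 2)) := by
      rw [hsm, ht, div_mul_eq_div_div, one_div, inv_mul_eq_div, div_right_comm]
    rw [e]
    linarith
  have hMstar : (⌊X⌋₊ : ℝ) ≤ Mstar (m + 1) ε P := by
    exact_mod_cast le_csSup (bddAbove_setOf_isCode (m + 1) hε.2) hcode
  have hlogM : Real.log X - Real.log 2 ≤ Real.log (Mstar (m + 1) ε P) :=
    (log_natFloor_ge hX1).trans (Real.log_le_log (by exact_mod_cast hM0) hMstar)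
  have hlogX : Real.log X = Real.log m / 2 + m / 2 * Real.log (1 + k ^ 2) := by
    rw [hX, Real.log_mul (by positivity) (by positivity), Real.log_sqrt (by positivity),
      Real.log_rpow (by positivity)]
  have hlogm : Real.log ((m : ℝ) + 1) - Real.log 2 ≤ Real.log m := by
    rw [← Real.log_div (by positivity) (by norm_num)]
    exact Real.log_le_log (by positivity) (by linarith)
  have hlogk : Real.log (1 + k ^ 2) ≤ Real.log (1 + A ^ 2) := by
    have : k ≤ A := by
      have h1 : a * t ≤ |a| := (mul_le_mul_of_nonneg_right (le_abs_self a) ht0.le).trans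
        (mul_le_of_le_one_right (abs_nonneg a) ht1)
      have h2 : -(d * t ^ 2) ≤ |d| := by
        rw [← neg_mul]
        exact (mul_le_mul_of_nonneg_right (neg_le_abs d) (by positivity)).trans
          (mul_le_of_le_one_right (abs_nonneg d) (pow_le_one₀ ht0.le ht1))
      rw [hkdef, hA, amplitude]
      linarith
    exact Real.log_le_log (by positivity) (by gcongr)
  have hrate := mul_le_mul_of_nonneg_left (hc₁ t ⟨ht0.le, ht1⟩)
    (show 0 ≤ ((m : ℝ) + 1) / 2 by positivity)
  have hV : √((m + 1) * gaussV P) = s * (√P * √(1 + P / 2) / (1 + P)) := by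
    rw [Real.sqrt_mul (by positivity), hs, gaussV,
      show P * (P + 2) / (2 * (P + 1) ^ 2) = P * (1 + P / 2) / (1 + P) ^ 2 by field_simp; ring,
      Real.sqrt_div (by positivity), Real.sqrt_mul hP.le, Real.sqrt_sq (by positivity)]
  have e : ((m : ℝ) + 1) / 2 * (Real.log (1 + P) + 2 * √P * a / (1 + P) * t - c₁ * t ^ 2) =
      (m + 1) * gaussC P + √((m + 1) * gaussV P) * PhiInv ε - c₁ / 2 := by
    rw [hV, gaussC, ← hs2, ha, ht]
    field_simp
  rw [e, ← hkdef] at hrate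
  have hlog2 : 0 < Real.log 2 := Real.log_pos (by norm_num)
  have hc := le_abs_self c₁
  linarith

end
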